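/- arXiv:2001.02946 — 5 statements merged into one kernel-verified Lean document; each statement's English description precedes it below -/
import Mathlib

section
/- Let G be a connected subcubic graph of order n ≥ 2 with no isolated vertex. Then i(G) = n/2 if and only if one of the following holds: (a) G is isomorphic to one of the five graphs G_1 = K_{2,2}, G_2 = K_{3,3}, G_3 (obtained from K_{2,3} by attaching a pendant vertex to one of the three degree-2 vertices), G_4 = the double star S(2,2), or G_5 (obtained from the path a_1a_2a_3a_4a_5a_6 by adding the edge a_2a_5); (b) n = 2k for some k ≥ 1 and G is isomorphic to cor(P_k); or (c) n = 2k for some k ≥ 3 and G is isomorphic to cor(C_k). -/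
open SimpleGraph

/-- `S` is an independent dominating set of `G`. -/
def IsIndepDomSet {V : Type*} (G : SimpleGraph V) (S : Set V) : Prop :=
  (∀ v ∉ S, ∃ u ∈ S, G.Adj u v) ∧ ∀ u ∈ S, ∀ v ∈ S, ¬ G.Adj u v

/-- The independent domination number `i(G)`. -/
noncomputable def indepDomNum {V : Type*} (G : SimpleGraph V) : ℕ :=
  sInf {k | ∃ S : Set V, IsIndepDomSet G S ∧ S.ncard = k}

/-- The corona `cor(G)` of a graph `G`: for each vertex `v` of `G` a new pendant
vertex `(v, true)` is attached to `(v, false)`, a copy of `v`. -/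
def corona {V : Type*} (G : SimpleGraph V) : SimpleGraph (V × Bool) :=
  SimpleGraph.fromRel (fun p q =>
    (p.2 = false ∧ q.2 = false ∧ G.Adj p.1 q.1) ∨
    (p.1 = q.1 ∧ p.2 = false ∧ q.2 = true))

/-- The graph `G₃`: `K_{2,3}` with a pendant vertex attached to a degree-2
vertex.  Vertices `0,1` are `a₁,a₂`; vertices `2,3,4` are `b₁,b₂,b₃`; vertex
`5` is the pendant vertex `w` attached to `b₃`. -/
def graphG3 : SimpleGraph (Fin 6) :=
  SimpleGraph.fromRel (fun p q =>
    (p = 0 ∧ q = 2) ∨ (p = 0 ∧ q = 3) ∨ (p = 0 ∧ q = 4) ∨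
    (p = 1 ∧ q = 2) ∨ (p = 1 ∧ q = 3) ∨ (p = 1 ∧ q = 4) ∨ (p = 4 ∧ q = 5))

/-- The double star `S(2,2)`: adjacent centers `0, 1`, with leaves `2, 3`
attached to `0` and leaves `4, 5` attached to `1`. -/
def doubleStar22 : SimpleGraph (Fin 6) :=
  SimpleGraph.fromRel (fun p q =>
    (p = 0 ∧ q = 1) ∨ (p = 0 ∧ q = 2) ∨ (p = 0 ∧ q = 3) ∨
    (p = 1 ∧ q = 4) ∨ (p = 1 ∧ q = 5))

/-- The graph `G₅`: the path `0 1 2 3 4 5` together with the edge `1–4`. -/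
def graphG5 : SimpleGraph (Fin 6) :=
  SimpleGraph.fromRel (fun p q =>
    (p = 0 ∧ q = 1) ∨ (p = 1 ∧ q = 2) ∨ (p = 2 ∧ q = 3) ∨
    (p = 3 ∧ q = 4) ∨ (p = 4 ∧ q = 5) ∨ (p = 1 ∧ q = 4))

/-- The vertices other than `v` all of whose neighbours are neighbours of `v`. -/
def nbrSubset {V : Type*} (G : SimpleGraph V) (v : V) : Set V :=
  {w | w ≠ v ∧ ∀ x, G.Adj w x → G.Adj v x}

lemma exists_isIndepDomSet_of_induce {V : Type*} [Fintype V] (G : SimpleGraph V)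
    (v : V)
    (ih : ∀ W : Set V, v ∉ W → (∀ a ∈ W, ∃ b ∈ W, G.Adj a b) →
      ∃ S : Set W, IsIndepDomSet (G.induce W) S ∧ 2 * S.ncard ≤ W.ncard) :
    ∃ S : Set V, IsIndepDomSet G S ∧
      2 * S.ncard + (G.neighborSet v).ncard ≤ Fintype.card V + 1 + (nbrSubset G v).ncard := by
  have hadj : ∀ w ∈ nbrSubset G v, ¬ G.Adj v w := fun w hw h => G.irrefl (hw.2 v h.symm)
  set D : Set V := insert v (G.neighborSet v) with hD
  have hvD : v ∈ D := Set.mem_insert _ _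
  have hdisj : Disjoint D (nbrSubset G v) := by
    rw [Set.disjoint_left]
    rintro x (rfl | hx) hx'
    · exact hx'.1 rfl
    · exact hadj x hx' hx
  set W : Set V := (D ∪ nbrSubset G v)ᶜ with hW
  have hcard : W.ncard + (D.ncard + (nbrSubset G v).ncard) = Fintype.card V := by
    rw [← Set.ncard_union_eq hdisj, ← Nat.card_eq_fintype_card, add_comm, Set.ncard_add_ncard_compl]
  have hDcard : D.ncard = (G.neighborSet v).ncard + 1 :=
    Set.ncard_insert_of_notMem (by simp)
  have hnoiso : ∀ a ∈ W, ∃ b ∈ W, G.Adj a b := by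
    intro a ha
    simp only [hW, hD, Set.mem_compl_iff, Set.mem_union, Set.mem_insert_iff,
      mem_neighborSet, not_or] at ha
    obtain ⟨⟨hav, hva⟩, haI⟩ := ha
    have : ∃ x, G.Adj a x ∧ ¬ G.Adj v x := by
      by_contra! h
      exact haI ⟨hav, h⟩
    obtain ⟨b, hab, hvb⟩ := this
    refine ⟨b, ?_, hab⟩
    rintro ((rfl | hb) | hb)
    · exact hva hab.symm
    · exact hvb hb
    · exact hva (hb.2 a hab.symm)
  obtain ⟨S, ⟨hdom, hind⟩, hScard⟩ := ih W (fun h => h (Or.inl hvD)) hnoiso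
  have hIW : ∀ x ∈ nbrSubset G v, ∀ y ∈ W, ¬ G.Adj x y := fun x hx y hy h =>
    hy (Or.inl (Or.inr (hx.2 y h)))
  have hII : ∀ x ∈ nbrSubset G v, ∀ y ∈ nbrSubset G v, ¬ G.Adj x y := fun x hx y hy h =>
    hadj y hy (hx.2 y h)
  have hvW : ∀ y ∈ W, ¬ G.Adj v y := fun y hy h => hy (Or.inl (Or.inr h))
  have himg : ∀ y ∈ (Subtype.val '' S : Set V), y ∈ W := by
    rintro _ ⟨y, -, rfl⟩
    exact y.2
  refine ⟨insert v (nbrSubset G v ∪ Subtype.val '' S), ⟨?_, ?_⟩, ?_⟩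
  · intro x hx
    by_cases hxW : x ∈ W
    · have hxS : (⟨x, hxW⟩ : W) ∉ S := fun h => hx (Or.inr (Or.inr ⟨_, h, rfl⟩))
      obtain ⟨u, hu, hux⟩ := hdom _ hxS
      exact ⟨u, Or.inr (Or.inr ⟨u, hu, rfl⟩), hux⟩
    · rw [hW, Set.notMem_compl_iff] at hxW
      rcases hxW with (rfl | h) | h
      · exact absurd (Or.inl rfl) hx
      · exact ⟨v, Or.inl rfl, h⟩
      · exact absurd (Or.inr (Or.inl h)) hx
  · rintro x (rfl | hx | hx) y (rfl | hy | hy) h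
    · exact G.irrefl h
    · exact hadj y hy h
    · exact hvW y (himg y hy) h
    · exact hadj x hx h.symm
    · exact hII x hx y hy h
    · exact hIW x hx y (himg y hy) h
    · exact hvW x (himg x hx) h.symm
    · exact hIW y hy x (himg x hx) h.symm
    · obtain ⟨x, hx, rfl⟩ := hx
      obtain ⟨y, hy, rfl⟩ := hy
      exact hind x hx y hy h
  · have h1 := Set.ncard_insert_le v (nbrSubset G v ∪ Subtype.val '' S)
    have h2 := Set.ncard_union_le (nbrSubset G v) (Subtype.val '' S)
    have h3 := Set.ncard_image_le (f := Subtype.val) S.toFinite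
    omega

lemma eq_or_eq_or_eq_of_adj {V : Type*} [Finite V] {G : SimpleGraph V} {v a b c : V}
    (hv : (G.neighborSet v).ncard ≤ 3) (ha : G.Adj v a) (hb : G.Adj v b) (hc : G.Adj v c)
    (hab : a ≠ b) (hac : a ≠ c) (hbc : b ≠ c) (x : V) (hx : G.Adj v x) :
    x = a ∨ x = b ∨ x = c := by
  have hsub : ({a, b, c} : Set V) ⊆ G.neighborSet v := by
    rintro y (rfl | rfl | rfl) <;> assumption
  have hcard : ({a, b, c} : Set V).ncard = 3 := Set.ncard_eq_three.2 ⟨a, b, c, hab, hac, hbc, rfl⟩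
  have heq := Set.eq_of_subset_of_ncard_le hsub (by omega)
  have : x ∈ ({a, b, c} : Set V) := by rw [heq]; exact hx
  simpa using this

lemma neighborSet_cases {V : Type*} [Finite V] {G : SimpleGraph V} {v : V}
    (hv : (G.neighborSet v).ncard ≤ 3) (hiso : ∃ u, G.Adj v u) :
    ((G.neighborSet v).ncard = 1 ∧ ∃ a, ∀ x, G.Adj v x ↔ x = a) ∨
    ((G.neighborSet v).ncard = 2 ∧ ∃ a b, a ≠ b ∧ ∀ x, G.Adj v x ↔ x = a ∨ x = b) ∨
    ((G.neighborSet v).ncard = 3 ∧ ∃ a b c, a ≠ b ∧ a ≠ c ∧ b ≠ c ∧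
      ∀ x, G.Adj v x ↔ x = a ∨ x = b ∨ x = c) := by
  have hpos : 0 < (G.neighborSet v).ncard := (Set.ncard_pos).2 hiso
  have h : (G.neighborSet v).ncard = 1 ∨ (G.neighborSet v).ncard = 2 ∨
    (G.neighborSet v).ncard = 3 := by omega
  rcases h with h | h | h
  · obtain ⟨a, ha⟩ := Set.ncard_eq_one.1 h
    exact Or.inl ⟨h, a, fun x => by rw [← mem_neighborSet, ha]; simp⟩
  · obtain ⟨a, b, hab, ha⟩ := Set.ncard_eq_two.1 h
    exact Or.inr (Or.inl ⟨h, a, b, hab, fun x => by rw [← mem_neighborSet, ha]; simp⟩)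
  · obtain ⟨a, b, c, hab, hac, hbc, ha⟩ := Set.ncard_eq_three.1 h
    exact Or.inr (Or.inr ⟨h, a, b, c, hab, hac, hbc,
      fun x => by rw [← mem_neighborSet, ha]; simp⟩)

lemma exists_pair_of_two_le_ncard {α : Type*} {s : Set α} (hs : 2 ≤ s.ncard) :
    ∃ x ∈ s, ∃ y ∈ s, x ≠ y :=
  (Set.one_lt_ncard_iff_nontrivial_and_finite.1 hs).1

lemma exists_ncard_nbrSubset_lt {V : Type*} [Finite V] [Nonempty V] (G : SimpleGraph V)
    (hsub : ∀ v, (G.neighborSet v).ncard ≤ 3) (hiso : ∀ v, ∃ u, G.Adj v u) :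
    ∃ v, (nbrSubset G v).ncard < (G.neighborSet v).ncard := by
  by_contra! hge
  have hleaf : ∀ l s, ¬ ∀ x, G.Adj l x ↔ x = s := by
    intro l s hl
    have hl1 : (G.neighborSet l).ncard = 1 := Set.ncard_eq_one.2 ⟨s, by ext; simp [hl]⟩
    obtain ⟨w, hwl, hw⟩ := (Set.ncard_pos).1 (hl1.symm.le.trans (hge l))
    have hsl : G.Adj s l := ((hl s).2 rfl).symm
    have hws : ∀ x, G.Adj w x → x = s := fun x hx => (hl x).1 (hw x hx)
    have hsw : G.Adj s w := by
      obtain ⟨u, hu⟩ := hiso w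
      rw [← hws u hu]
      exact hu.symm
    have hkey : ∀ z ∈ nbrSubset G s, ∃ c, c ≠ l ∧ c ≠ w ∧ G.Adj s c ∧ G.Adj c z := by
      rintro z ⟨hzs, hz⟩
      obtain ⟨c, hc⟩ := hiso z
      refine ⟨c, ?_, ?_, hz c hc, hc.symm⟩
      · rintro rfl
        exact hzs ((hl z).1 hc.symm)
      · rintro rfl
        exact hzs (hws z hc.symm)
    obtain ⟨z, hz⟩ := (Set.ncard_pos).1 (((Set.ncard_pos).2 ⟨l, hsl⟩).trans_le (hge s))
    obtain ⟨c, hcl, hcw, hsc, -⟩ := hkey z hz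
    have hN := eq_or_eq_or_eq_of_adj (hsub s) hsl hsw hsc hwl.symm hcl.symm hcw.symm
    have h3 : 3 ≤ (G.neighborSet s).ncard :=
      (Set.ncard_eq_three.2 ⟨l, w, c, hwl.symm, hcl.symm, hcw.symm, rfl⟩).symm.le.trans
        (Set.ncard_le_ncard (t := G.neighborSet s) (by
          rintro y (rfl | rfl | rfl) <;> assumption))
    have hsub' : insert s (nbrSubset G s) ⊆ G.neighborSet c := by
      rintro y (rfl | hy)
      · exact hsc.symm
      · obtain ⟨d, hdl, hdw, hsd, hdy⟩ := hkey y hy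
        rcases hN d hsd with rfl | rfl | rfl
        · exact absurd rfl hdl
        · exact absurd rfl hdw
        · exact hdy
    have := Set.ncard_le_ncard hsub'
    rw [Set.ncard_insert_of_notMem (fun h => h.1 rfl)] at this
    have := hge s
    have := hsub c
    omega
  have hdeg : ∀ v, (G.neighborSet v).ncard = 3 := by
    intro v
    rcases neighborSet_cases (hsub v) (hiso v) with ⟨-, a, h⟩ | ⟨h2, a, b, hab, h⟩ | ⟨h, -⟩
    · exact absurd h (hleaf v a)
    · exfalso
      obtain ⟨w, hw, w', hw', hww⟩ := exists_pair_of_two_le_ncard (h2.symm.le.trans (hge v))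
      have hN : ∀ w ∈ nbrSubset G v, G.Adj w a := by
        rintro w ⟨hwv, hw⟩
        by_contra hwa
        refine hleaf w b fun x => ⟨fun hx => ?_, ?_⟩
        · rcases (h x).1 (hw x hx) with rfl | rfl
          · exact absurd hx hwa
          · rfl
        · rintro rfl
          obtain ⟨u, hu⟩ := hiso w
          rcases (h u).1 (hw u hu) with rfl | rfl
          · exact absurd hu hwa
          · exact hu
      have hva : G.Adj v a := (h a).2 (Or.inl rfl)
      have hNa := eq_or_eq_or_eq_of_adj (hsub a) hva.symm (hN w hw).symm (hN w' hw').symm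
        hw.1.symm hw'.1.symm hww
      have h3 : 3 ≤ (G.neighborSet a).ncard :=
        (Set.ncard_eq_three.2 ⟨v, w, w', hw.1.symm, hw'.1.symm, hww, rfl⟩).symm.le.trans
          (Set.ncard_le_ncard (t := G.neighborSet a) (by
            rintro y (rfl | rfl | rfl)
            exacts [hva.symm, (hN _ hw).symm, (hN _ hw').symm]))
      have hsub' : nbrSubset G a ⊆ {b} := by
        rintro y ⟨hya, hy⟩
        obtain ⟨u, hu⟩ := hiso y
        have hvy : G.Adj v y := by
          rcases hNa u (hy u hu) with rfl | rfl | rfl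
          · exact hu.symm
          · exact hw.2 y hu.symm
          · exact hw'.2 y hu.symm
        exact ((h y).1 hvy).resolve_left hya
      have := Set.ncard_le_ncard hsub'
      rw [Set.ncard_singleton] at this
      have := hge a
      omega
    · exact h
  obtain ⟨v⟩ := ‹Nonempty V›
  obtain ⟨a, ha⟩ := hiso v
  have hsub' : insert v (nbrSubset G v) ⊆ G.neighborSet a := by
    rintro y (rfl | ⟨-, hy⟩)
    · exact ha.symm
    · have heq : G.neighborSet y = G.neighborSet v :=
        Set.eq_of_subset_of_ncard_le hy (by rw [hdeg, hdeg])
      have : a ∈ G.neighborSet y := heq ▸ ha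
      exact this.symm
  have := Set.ncard_le_ncard hsub'
  rw [Set.ncard_insert_of_notMem (fun h => h.1 rfl)] at this
  have := hge v
  have := hdeg v
  have := hsub a
  omega

lemma ncard_neighborSet_induce_le {V : Type*} [Finite V] (G : SimpleGraph V) (W : Set V) (w : W) :
    ((G.induce W).neighborSet w).ncard ≤ (G.neighborSet w).ncard := by
  rw [← Set.ncard_image_of_injective _ Subtype.val_injective]
  refine Set.ncard_le_ncard ?_
  rintro _ ⟨x, hx, rfl⟩
  exact hx

lemma exists_isIndepDomSet_two_mul_ncard_le {V : Type*} [Fintype V] (G : SimpleGraph V)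
    (hsub : ∀ v, (G.neighborSet v).ncard ≤ 3) (hiso : ∀ v, ∃ u, G.Adj v u) :
    ∃ S : Set V, IsIndepDomSet G S ∧ 2 * S.ncard ≤ Fintype.card V := by
  classical
  induction hn : Fintype.card V using Nat.strong_induction_on generalizing V with
  | _ n ih =>
    rcases isEmpty_or_nonempty V with hV | hV
    · exact ⟨∅, ⟨fun v => hV.elim v, fun v => hV.elim v⟩, by simp⟩
    · obtain ⟨v, hv⟩ := exists_ncard_nbrSubset_lt G hsub hiso
      obtain ⟨S, hS, hcard⟩ := exists_isIndepDomSet_of_induce G v (fun W hvW hW => by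
        have hlt : W.ncard < n := by
          rw [← hn, ← Nat.card_eq_fintype_card]
          exact Set.ncard_lt_card (fun h => hvW (h ▸ Set.mem_univ v))
        rw [← Nat.card_coe_set_eq, Nat.card_eq_fintype_card] at hlt ⊢
        refine ih _ hlt (G.induce W)
          (fun w => (ncard_neighborSet_induce_le G W w).trans (hsub w)) ?_ rfl
        rintro ⟨a, ha⟩
        obtain ⟨b, hb, hab⟩ := hW a ha
        exact ⟨⟨b, hb⟩, hab⟩)
      exact ⟨S, hS, by omega⟩

lemma indepDomNum_le {V : Type*} {G : SimpleGraph V} {S : Set V} (hS : IsIndepDomSet G S) :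
    indepDomNum G ≤ S.ncard :=
  Nat.sInf_le ⟨S, hS, rfl⟩

lemma exists_ncard_eq_indepDomNum {V : Type*} [Fintype V] (G : SimpleGraph V)
    (hsub : ∀ v, (G.neighborSet v).ncard ≤ 3) (hiso : ∀ v, ∃ u, G.Adj v u) :
    ∃ S : Set V, IsIndepDomSet G S ∧ S.ncard = indepDomNum G := by
  obtain ⟨S, hS, -⟩ := exists_isIndepDomSet_two_mul_ncard_le G hsub hiso
  exact Nat.sInf_mem (s := {k | ∃ S : Set V, IsIndepDomSet G S ∧ S.ncard = k}) ⟨_, S, hS, rfl⟩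

lemma ncard_neighborSet_le_nbrSubset {V : Type*} [Fintype V] (G : SimpleGraph V)
    (hsub : ∀ v, (G.neighborSet v).ncard ≤ 3)
    (htight : 2 * indepDomNum G = Fintype.card V) (v : V) :
    (G.neighborSet v).ncard ≤ (nbrSubset G v).ncard + 1 := by
  classical
  obtain ⟨S, hS, hcard⟩ := exists_isIndepDomSet_of_induce G v (fun W _ hW => by
    rw [← Nat.card_coe_set_eq, Nat.card_eq_fintype_card]
    refine exists_isIndepDomSet_two_mul_ncard_le (G.induce W)
      (fun w => (ncard_neighborSet_induce_le G W w).trans (hsub w)) ?_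
    rintro ⟨a, ha⟩
    obtain ⟨b, hb, hab⟩ := hW a ha
    exact ⟨⟨b, hb⟩, hab⟩)
  have := indepDomNum_le hS
  omega

lemma two_mul_indepDomNum_eq {V W : Type*} [Fintype V] [Fintype W] (G : SimpleGraph V)
    (hsub : ∀ v, (G.neighborSet v).ncard ≤ 3) (hiso : ∀ v, ∃ u, G.Adj v u)
    {H : SimpleGraph W} (e : G ≃g H)
    (hH : ∀ S : Set W, IsIndepDomSet H S → Fintype.card W ≤ 2 * S.ncard) :
    2 * indepDomNum G = Fintype.card V := by
  obtain ⟨S, hS, hcard⟩ := exists_isIndepDomSet_two_mul_ncard_le G hsub hiso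
  obtain ⟨T, ⟨hdom, hind⟩, hTcard⟩ := exists_ncard_eq_indepDomNum G hsub hiso
  have hle := indepDomNum_le hS
  have := hH (e '' T) ⟨fun w hw => ?_, ?_⟩
  · rw [Set.ncard_image_of_injective _ e.injective, ← Fintype.card_congr e.toEquiv] at this
    omega
  · obtain ⟨v, rfl⟩ := e.surjective w
    obtain ⟨u, hu, huv⟩ := hdom v (fun h => hw ⟨v, h, rfl⟩)
    exact ⟨e u, ⟨u, hu, rfl⟩, e.map_adj_iff.2 huv⟩
  · rintro _ ⟨u, hu, rfl⟩ _ ⟨v, hv, rfl⟩ h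
    exact hind u hu v hv (e.map_adj_iff.1 h)

lemma card_le_two_mul_ncard_of_finset {n : Type*} [Fintype n] {H : SimpleGraph n} {m : ℕ}
    (h : ∀ S : Finset n, (∀ v, v ∉ S → ∃ u ∈ S, H.Adj u v) →
      (∀ u ∈ S, ∀ v ∈ S, ¬ H.Adj u v) → m ≤ 2 * S.card)
    (S : Set n) (hS : IsIndepDomSet H S) : m ≤ 2 * S.ncard := by
  classical
  rw [Set.ncard_eq_toFinset_card']
  exact h _ (by simpa using hS.1) (by simpa using hS.2)

instance decidableRelCompleteBipartiteGraph {m n : ℕ} :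
    DecidableRel (completeBipartiteGraph (Fin m) (Fin n)).Adj :=
  fun _ _ => by unfold completeBipartiteGraph; infer_instance

instance decidableRelGraphG3 : DecidableRel graphG3.Adj :=
  fun _ _ => by unfold graphG3; infer_instance

instance decidableRelDoubleStar22 : DecidableRel doubleStar22.Adj :=
  fun _ _ => by unfold doubleStar22; infer_instance

instance decidableRelGraphG5 : DecidableRel graphG5.Adj :=
  fun _ _ => by unfold graphG5; infer_instance

lemma isIndepDomSet_K22 (S : Set (Fin 2 ⊕ Fin 2))
    (hS : IsIndepDomSet (completeBipartiteGraph (Fin 2) (Fin 2)) S) : 4 ≤ 2 * S.ncard :=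
  card_le_two_mul_ncard_of_finset (by decide) S hS

set_option maxRecDepth 4000 in
lemma isIndepDomSet_K33 (S : Set (Fin 3 ⊕ Fin 3))
    (hS : IsIndepDomSet (completeBipartiteGraph (Fin 3) (Fin 3)) S) : 6 ≤ 2 * S.ncard :=
  card_le_two_mul_ncard_of_finset (by decide) S hS

set_option maxRecDepth 4000 in
lemma isIndepDomSet_graphG3 (S : Set (Fin 6)) (hS : IsIndepDomSet graphG3 S) : 6 ≤ 2 * S.ncard :=
  card_le_two_mul_ncard_of_finset (by decide) S hS

set_option maxRecDepth 4000 in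
lemma isIndepDomSet_doubleStar22 (S : Set (Fin 6)) (hS : IsIndepDomSet doubleStar22 S) :
    6 ≤ 2 * S.ncard :=
  card_le_two_mul_ncard_of_finset (by decide) S hS

set_option maxRecDepth 4000 in
lemma isIndepDomSet_graphG5 (S : Set (Fin 6)) (hS : IsIndepDomSet graphG5 S) : 6 ≤ 2 * S.ncard :=
  card_le_two_mul_ncard_of_finset (by decide) S hS

lemma corona_adj {V : Type*} (G : SimpleGraph V) (p q : V × Bool) :
    (corona G).Adj p q ↔ (p.2 = false ∧ q.2 = false ∧ G.Adj p.1 q.1) ∨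
      (p.1 = q.1 ∧ p.2 ≠ q.2) := by
  obtain ⟨a, i⟩ := p
  obtain ⟨b, j⟩ := q
  rw [corona, fromRel_adj]
  cases i <;> cases j <;> simp [G.adj_comm b a, eq_comm (a := b)]
  exact fun h => h.ne

lemma isIndepDomSet_corona {W : Type*} [Fintype W] (H : SimpleGraph W) (S : Set (W × Bool))
    (hS : IsIndepDomSet (corona H) S) : Fintype.card (W × Bool) ≤ 2 * S.ncard := by
  have hsurj : Prod.fst '' S = Set.univ := by
    refine Set.eq_univ_of_forall fun w => ?_
    by_cases hw : (w, true) ∈ S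
    · exact ⟨_, hw, rfl⟩
    · obtain ⟨u, hu, hadj⟩ := hS.1 _ hw
      rw [corona_adj] at hadj
      simp only [Bool.true_eq_false, false_and, and_false, false_or] at hadj
      exact ⟨u, hu, hadj.1⟩
  have := Set.ncard_image_le (f := Prod.fst) S.toFinite
  rw [hsurj, Set.ncard_univ, Nat.card_eq_fintype_card] at this
  simp only [Fintype.card_prod, Fintype.card_bool]
  omega

lemma nonempty_corona_iso {V W : Type*} {G : SimpleGraph V} {H : SimpleGraph W}
    (h : Nonempty (G ≃g H)) : Nonempty (corona G ≃g corona H) := by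
  obtain ⟨e⟩ := h
  refine ⟨⟨e.toEquiv.prodCongr (Equiv.refl Bool), ?_⟩⟩
  intro p q
  simp [corona_adj, e.map_adj_iff]

lemma nonempty_iso_of_injective {V W : Type*} {G : SimpleGraph V} {H : SimpleGraph W} [Nonempty W]
    (hG : ∀ A : Set V, A.Nonempty → (∀ a ∈ A, ∀ b, G.Adj a b → b ∈ A) → A = Set.univ)
    (f : W → V) (hf : Function.Injective f) (hmap : ∀ i j, H.Adj i j → G.Adj (f i) (f j))
    (hlift : ∀ i x, G.Adj (f i) x → ∃ j, H.Adj i j ∧ f j = x) : Nonempty (G ≃g H) := by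
  have hrange : Set.range f = Set.univ := by
    refine hG _ (Set.range_nonempty f) ?_
    rintro _ ⟨i, rfl⟩ x hx
    obtain ⟨j, -, rfl⟩ := hlift i x hx
    exact ⟨j, rfl⟩
  refine ⟨(RelIso.symm ⟨Equiv.ofBijective f ⟨hf, Set.range_eq_univ.1 hrange⟩, ?_⟩)⟩
  intro i j
  refine ⟨fun h => ?_, hmap i j⟩
  obtain ⟨k, hk, hkj⟩ := hlift i _ h
  rwa [← hf hkj]

lemma SimpleGraph.Connected.eq_univ_of_closed {V : Type*} {G : SimpleGraph V} (hG : G.Connected)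
    (A : Set V) (hA : A.Nonempty) (hcl : ∀ a ∈ A, ∀ b, G.Adj a b → b ∈ A) : A = Set.univ := by
  obtain ⟨a, ha⟩ := hA
  refine Set.eq_univ_of_forall fun b => ?_
  obtain ⟨p⟩ := hG.preconnected a b
  induction p with
  | nil => exact ha
  | cons h _ ih => exact ih (hcl _ ha _ h)

/-- `f` enumerates a path of `k` vertices. -/
def IsPathEnum {V : Type*} (G : SimpleGraph V) (k : ℕ) (f : ℕ → V) : Prop :=
  Set.InjOn f (Set.Iio k) ∧ ∀ i, i + 1 < k → G.Adj (f i) (f (i + 1))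

lemma exists_isPathEnum_closed {V : Type*} [Finite V] [Nonempty V] (G : SimpleGraph V)
    (hdeg : ∀ v a b c, G.Adj v a → G.Adj v b → G.Adj v c → a = b ∨ a = c ∨ b = c) :
    ∃ k f, 1 ≤ k ∧ IsPathEnum G k f ∧ ∀ i < k, ∀ x, G.Adj (f i) x → ∃ j < k, f j = x := by
  classical
  have hone : ∃ f, IsPathEnum G 1 f := by
    obtain ⟨v⟩ := ‹Nonempty V›
    refine ⟨fun _ => v, fun i hi j hj _ => ?_, fun i hi => by omega⟩
    simp only [Set.mem_Iio] at hi hj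
    omega
  have hbound : ∀ k, (∃ f, IsPathEnum G k f) → k ≤ Nat.card V := by
    rintro k ⟨f, hf, -⟩
    have := Set.ncard_le_card (f '' Set.Iio k)
    rwa [Set.InjOn.ncard_image hf, ← Finset.coe_Iio, Set.ncard_coe_finset, Nat.card_Iio] at this
  have hV : 1 ≤ Nat.card V := hbound 1 hone
  obtain ⟨k, hk, ⟨f, hf⟩, hmax⟩ : ∃ k, 1 ≤ k ∧ (∃ f, IsPathEnum G k f) ∧
      ¬ ∃ f, IsPathEnum G (k + 1) f := by
    refine ⟨Nat.findGreatest (fun k => ∃ f, IsPathEnum G k f) (Nat.card V),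
      Nat.le_findGreatest hV hone,
      Nat.findGreatest_spec (P := fun k => ∃ f, IsPathEnum G k f) hV hone, fun h => ?_⟩
    have := Nat.le_findGreatest (P := fun k => ∃ f, IsPathEnum G k f) (hbound _ h) h
    omega
  refine ⟨k, f, hk, hf, fun i hi x hx => ?_⟩
  by_contra! hne
  rcases Nat.eq_zero_or_pos i with rfl | hi0
  · refine hmax ⟨fun n => Nat.casesOn n x f, ?_, ?_⟩
    · rintro (_ | a) ha (_ | b) hb hab
      · rfl
      · simp only [Set.mem_Iio] at hb
        exact absurd hab.symm (hne b (by omega))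
      · simp only [Set.mem_Iio] at ha
        exact absurd hab (hne a (by omega))
      · simp only [Set.mem_Iio] at ha hb
        rw [hf.1 (Set.mem_Iio.2 (by omega : a < k)) (Set.mem_Iio.2 (by omega : b < k)) hab]
    · rintro (_ | a) ha
      · exact hx.symm
      · exact hf.2 a (by omega)
  · by_cases hik : i + 1 = k
    · refine hmax ⟨Function.update f k x, ?_, ?_⟩
      · intro a ha b hb hab
        simp only [Set.mem_Iio] at ha hb
        rcases eq_or_ne a k with hak | hak <;> rcases eq_or_ne b k with hbk | hbk
        · rw [hak, hbk]
        · subst hak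
          rw [Function.update_self, Function.update_of_ne hbk] at hab
          exact absurd hab.symm (hne b (by omega))
        · subst hbk
          rw [Function.update_self, Function.update_of_ne hak] at hab
          exact absurd hab (hne a (by omega))
        · rw [Function.update_of_ne hak, Function.update_of_ne hbk] at hab
          exact hf.1 (Set.mem_Iio.2 (by omega)) (Set.mem_Iio.2 (by omega)) hab
      · intro a ha
        rw [Function.update_of_ne (by omega)]
        rcases eq_or_ne (a + 1) k with h | h
        · obtain rfl : a = i := by omega
          rw [h, Function.update_self]
          exact hx
        · rw [Function.update_of_ne h]
          exact hf.2 a (by omega)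
    · have h1 : G.Adj (f i) (f (i - 1)) := by
        have := hf.2 (i - 1) (by omega)
        rw [Nat.sub_add_cancel hi0] at this
        exact this.symm
      rcases hdeg _ _ _ _ h1 (hf.2 i (by omega)) hx with h | h | h
      · have := hf.1 (Set.mem_Iio.2 (by omega)) (Set.mem_Iio.2 (by omega)) h
        omega
      · exact hne _ (by omega) h
      · exact hne _ (by omega) h

lemma cycleGraph_adj_iff_val {k : ℕ} (hk : 3 ≤ k) {i j : Fin k} :
    (cycleGraph k).Adj i j ↔ j.1 = i.1 + 1 ∨ i.1 = j.1 + 1 ∨ (i.1 = 0 ∧ j.1 + 1 = k) ∨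
      (j.1 = 0 ∧ i.1 + 1 = k) := by
  rw [cycleGraph_adj']
  rcases lt_trichotomy i j with h | rfl | h
  · rw [Fin.coe_sub_iff_lt.2 h, Fin.coe_sub_iff_le.2 h.le]
    have : i.1 < j.1 := h
    omega
  · have : (i - i).val = 0 := by rw [Fin.coe_sub_iff_le.2 le_rfl]; omega
    omega
  · rw [Fin.coe_sub_iff_lt.2 h, Fin.coe_sub_iff_le.2 h.le]
    have : j.1 < i.1 := h
    omega

lemma nonempty_iso_pathGraph_or_cycleGraph {V : Type*} [Finite V] [Nonempty V] (G : SimpleGraph V)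
    (hG : ∀ A : Set V, A.Nonempty → (∀ a ∈ A, ∀ b, G.Adj a b → b ∈ A) → A = Set.univ)
    (hdeg : ∀ v a b c, G.Adj v a → G.Adj v b → G.Adj v c → a = b ∨ a = c ∨ b = c) :
    (∃ k, 1 ≤ k ∧ Nonempty (G ≃g pathGraph k)) ∨ ∃ k, 3 ≤ k ∧ Nonempty (G ≃g cycleGraph k) := by
  obtain ⟨k, f, hk, ⟨hinj, hadj⟩, hcl⟩ := exists_isPathEnum_closed G hdeg
  have hinj' : ∀ i j, i < k → j < k → f i = f j → i = j := fun i j hi hj h => hinj hi hj h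
  have hchord : ∀ i j, i < j → j < k → G.Adj (f i) (f j) → j = i + 1 ∨ (i = 0 ∧ j + 1 = k) := by
    intro i j hij hjk h
    by_contra! hne
    rcases Nat.eq_zero_or_pos i with rfl | hi0
    · have h1 := hadj (j - 1) (by omega)
      rw [Nat.sub_add_cancel (by omega)] at h1
      rcases hdeg _ _ _ _ h1.symm (hadj j (by omega)) h.symm with h | h | h <;>
      · have := hinj' _ _ (by omega) (by omega) h
        omega
    · have h1 := hadj (i - 1) (by omega)
      rw [Nat.sub_add_cancel (by omega)] at h1
      rcases hdeg _ _ _ _ h1.symm (hadj i (by omega)) h with h | h | h <;>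
      · have := hinj' _ _ (by omega) (by omega) h
        omega
  have : NeZero k := ⟨by omega⟩
  have hfin : Function.Injective fun i : Fin k => f i := fun i j h =>
    Fin.ext (hinj' _ _ i.2 j.2 h)
  by_cases hcyc : 3 ≤ k ∧ G.Adj (f 0) (f (k - 1))
  · right
    refine ⟨k, hcyc.1, nonempty_iso_of_injective hG (fun i : Fin k => f i) hfin ?_ ?_⟩
    · intro i j hij
      rcases (cycleGraph_adj_iff_val hcyc.1).1 hij with h | h | ⟨h, h'⟩ | ⟨h, h'⟩
      · simpa [h] using hadj i (by omega)
      · simpa [h] using (hadj j (by omega)).symm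
      · simpa [h, show j.1 = k - 1 by omega] using hcyc.2
      · simpa [h, show i.1 = k - 1 by omega] using hcyc.2.symm
    · intro i x hx
      obtain ⟨j, hj, rfl⟩ := hcl i i.2 x hx
      refine ⟨⟨j, hj⟩, (cycleGraph_adj_iff_val hcyc.1).2 ?_, rfl⟩
      rcases lt_trichotomy i.1 j with h | h | h
      · rcases hchord _ _ h hj hx with h' | h'
        · exact Or.inl h'
        · exact Or.inr (Or.inr (Or.inl h'))
      · subst h
        exact absurd hx G.irrefl
      · rcases hchord _ _ h i.2 hx.symm with h' | h'
        · exact Or.inr (Or.inl h')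
        · exact Or.inr (Or.inr (Or.inr h'))
  · left
    refine ⟨k, hk, nonempty_iso_of_injective hG (fun i : Fin k => f i) hfin ?_ ?_⟩
    · intro i j hij
      rcases pathGraph_adj.1 hij with h | h
      · simpa [h] using hadj i (by omega)
      · simpa [h] using (hadj j (by omega)).symm
    · intro i x hx
      obtain ⟨j, hj, rfl⟩ := hcl i i.2 x hx
      refine ⟨⟨j, hj⟩, ?_, rfl⟩
      rw [pathGraph_adj]
      rcases lt_trichotomy i.1 j with h | h | h
      · rcases hchord _ _ h hj hx with h' | ⟨h0, h1⟩
        · exact Or.inl h'.symm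
        · left
          by_contra hne
          refine hcyc ⟨?_, ?_⟩
          · simp only at hne
            omega
          · rw [← h1, Nat.add_sub_cancel, ← h0]
            exact hx
      · subst h
        exact absurd hx (G.irrefl)
      · rcases hchord _ _ h i.2 hx.symm with h' | ⟨h0, h1⟩
        · exact Or.inr h'.symm
        · right
          by_contra hne
          refine hcyc ⟨?_, ?_⟩
          · simp only at hne
            omega
          · rw [← h1, Nat.add_sub_cancel, ← h0]
            exact hx.symm

lemma nonempty_iso_corona {V : Type*} [Finite V] (G : SimpleGraph V)
    (hG : ∀ A : Set V, A.Nonempty → (∀ a ∈ A, ∀ b, G.Adj a b → b ∈ A) → A = Set.univ)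
    (hsub : ∀ v, (G.neighborSet v).ncard ≤ 3) (S : Set V) (hne : S.Nonempty)
    (hS : ∀ s ∈ S, ∃ l, l ∉ S ∧ (∀ x, G.Adj l x ↔ x = s) ∧ ∀ x, G.Adj s x → x = l ∨ x ∈ S) :
    (∃ k, 1 ≤ k ∧ Nonempty (G ≃g corona (pathGraph k))) ∨
      ∃ k, 3 ≤ k ∧ Nonempty (G ≃g corona (cycleGraph k)) := by
  choose! leaf hleafS hleaf hnbr using hS
  have hadj : ∀ s ∈ S, G.Adj s (leaf s) := fun s hs => ((hleaf s hs s).2 rfl).symm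
  have : Nonempty S := hne.to_subtype
  have hcor : Nonempty (G ≃g corona (G.induce S)) := by
    refine nonempty_iso_of_injective hG
      (fun p : S × Bool => if p.2 then leaf p.1 else (p.1 : V)) ?_ ?_ ?_
    · rintro ⟨⟨s, hs⟩, i⟩ ⟨⟨t, ht⟩, j⟩ h
      cases i <;> cases j
      · simpa using h
      · simp only [Bool.false_eq_true, if_false, if_true] at h
        exact absurd (h ▸ hs) (hleafS t ht)
      · simp only [Bool.false_eq_true, if_false, if_true] at h
        exact absurd (h ▸ ht) (hleafS s hs)
      · simp only [if_true] at h
        have h1 := (hadj s hs).symm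
        rw [h] at h1
        simpa using (hleaf t ht s).1 h1
    · rintro ⟨⟨s, hs⟩, i⟩ ⟨⟨t, ht⟩, j⟩ h
      rw [corona_adj] at h
      cases i <;> cases j <;> simp at h ⊢
      · exact h
      · exact h ▸ hadj s hs
      · exact h ▸ (hadj s hs).symm
    · rintro ⟨⟨s, hs⟩, i⟩ x h
      cases i
      · simp only [Bool.false_eq_true, if_false] at h
        rcases hnbr s hs x h with rfl | hx
        · exact ⟨(⟨s, hs⟩, true), by simp [corona_adj], by simp⟩
        · exact ⟨(⟨x, hx⟩, false), by simpa [corona_adj] using h, by simp⟩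
      · simp only [if_true] at h
        obtain rfl := (hleaf s hs x).1 h
        exact ⟨(⟨x, hs⟩, false), by simp [corona_adj], by simp⟩
  have htrans : ∀ {n : ℕ} {H : SimpleGraph (Fin n)}, Nonempty (G.induce S ≃g H) →
      Nonempty (G ≃g corona H) := fun h =>
    (nonempty_corona_iso h).elim fun e => hcor.elim fun e' => ⟨e'.trans e⟩
  refine (nonempty_iso_pathGraph_or_cycleGraph (G.induce S) ?_ ?_).imp
    (fun ⟨k, hk, h⟩ => ⟨k, hk, htrans h⟩) (fun ⟨k, hk, h⟩ => ⟨k, hk, htrans h⟩)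
  · intro A ⟨a, ha⟩ hcl
    have hmem : ∀ s ∈ S, s ∉ leaf '' (Subtype.val '' A) := by
      rintro _ hs ⟨_, ⟨t, -, rfl⟩, rfl⟩
      exact hleafS t t.2 hs
    have := hG (Subtype.val '' A ∪ leaf '' (Subtype.val '' A)) ⟨a, Or.inl ⟨a, ha, rfl⟩⟩ ?_
    · refine Set.eq_univ_of_forall fun s => ?_
      have hs := (this.symm ▸ Set.mem_univ (s : V) :
        (s : V) ∈ Subtype.val '' A ∪ leaf '' (Subtype.val '' A))
      obtain ⟨t, ht, hts⟩ := hs.resolve_right (hmem s s.2)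
      exact Subtype.ext hts ▸ ht
    · rintro _ (⟨s, hs, rfl⟩ | ⟨_, ⟨s, hs, rfl⟩, rfl⟩) x hx
      · rcases hnbr s s.2 x hx with rfl | hxS
        · exact Or.inr ⟨s, ⟨s, hs, rfl⟩, rfl⟩
        · exact Or.inl ⟨⟨x, hxS⟩, hcl s hs ⟨x, hxS⟩ hx, rfl⟩
      · rw [(hleaf s s.2 x).1 hx]
        exact Or.inl ⟨s, hs, rfl⟩
  · rintro ⟨v, hv⟩ ⟨a, ha⟩ ⟨b, hb⟩ ⟨c, hc⟩ hva hvb hvc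
    simp only [comap_adj, Function.Embedding.subtype_apply] at hva hvb hvc
    by_contra! hne
    simp only [ne_eq, Subtype.mk.injEq] at hne
    have hl := hleafS v hv
    rcases eq_or_eq_or_eq_of_adj (hsub v) hva hvb hvc hne.1 hne.2.1 hne.2.2 _ (hadj v hv) with
      h | h | h <;> rw [h] at hl
    exacts [hl ha, hl hb, hl hc]

lemma nonempty_iso_K22 {V : Type*} {G : SimpleGraph V}
    (hG : ∀ A : Set V, A.Nonempty → (∀ a ∈ A, ∀ b, G.Adj a b → b ∈ A) → A = Set.univ)
    {v w a b : V} (hvw : v ≠ w) (hab : a ≠ b)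
    (hv : ∀ x, G.Adj v x ↔ x = a ∨ x = b) (hw : ∀ x, G.Adj w x ↔ x = a ∨ x = b)
    (ha : ∀ x, G.Adj a x ↔ x = v ∨ x = w) (hb : ∀ x, G.Adj b x ↔ x = v ∨ x = w) :
    Nonempty (G ≃g completeBipartiteGraph (Fin 2) (Fin 2)) := by
  have hirr : ∀ x, ¬ G.Adj x x := fun x => G.irrefl
  have := (hv _).not.1 (hirr v)
  have := (hw _).not.1 (hirr w)
  refine nonempty_iso_of_injective hG (Sum.elim ![v, w] ![a, b]) ?_ ?_ ?_
  · rintro (i | i) (j | j) <;> fin_cases i <;> fin_cases j <;> simp <;> grind only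
  · rintro (i | i) (j | j) <;> fin_cases i <;> fin_cases j <;> simp [hv, hw, ha, hb]
  · rintro (i | i) <;> fin_cases i <;> simp [hv, hw, ha, hb]

lemma nonempty_iso_K33 {V : Type*} {G : SimpleGraph V}
    (hG : ∀ A : Set V, A.Nonempty → (∀ a ∈ A, ∀ b, G.Adj a b → b ∈ A) → A = Set.univ)
    {u v w a b c : V} (huv : u ≠ v) (huw : u ≠ w) (hvw : v ≠ w)
    (hab : a ≠ b) (hac : a ≠ c) (hbc : b ≠ c)
    (hu : ∀ x, G.Adj u x ↔ x = a ∨ x = b ∨ x = c) (hv : ∀ x, G.Adj v x ↔ x = a ∨ x = b ∨ x = c)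
    (hw : ∀ x, G.Adj w x ↔ x = a ∨ x = b ∨ x = c) (ha : ∀ x, G.Adj a x ↔ x = u ∨ x = v ∨ x = w)
    (hb : ∀ x, G.Adj b x ↔ x = u ∨ x = v ∨ x = w) (hc : ∀ x, G.Adj c x ↔ x = u ∨ x = v ∨ x = w) :
    Nonempty (G ≃g completeBipartiteGraph (Fin 3) (Fin 3)) := by
  have hirr : ∀ x, ¬ G.Adj x x := fun x => G.irrefl
  have := (hu _).not.1 (hirr u)
  have := (hv _).not.1 (hirr v)
  have := (hw _).not.1 (hirr w)
  refine nonempty_iso_of_injective hG (Sum.elim ![u, v, w] ![a, b, c]) ?_ ?_ ?_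
  · rintro (i | i) (j | j) <;> fin_cases i <;> fin_cases j <;> simp <;> grind only
  · rintro (i | i) (j | j) <;> fin_cases i <;> fin_cases j <;> simp [hu, hv, hw, ha, hb, hc]
  · rintro (i | i) <;> fin_cases i <;> simp [hu, hv, hw, ha, hb, hc, Fin.exists_fin_succ]

lemma nonempty_iso_graphG3 {V : Type*} {G : SimpleGraph V}
    (hG : ∀ A : Set V, A.Nonempty → (∀ a ∈ A, ∀ b, G.Adj a b → b ∈ A) → A = Set.univ)
    {s l x y u v : V} (hlx : l ≠ x) (hly : l ≠ y) (hxy : x ≠ y) (hsu : s ≠ u) (hsv : s ≠ v)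
    (huv : u ≠ v)
    (hs : ∀ z, G.Adj s z ↔ z = l ∨ z = x ∨ z = y) (hl : ∀ z, G.Adj l z ↔ z = s)
    (hx : ∀ z, G.Adj x z ↔ z = s ∨ z = u ∨ z = v) (hy : ∀ z, G.Adj y z ↔ z = s ∨ z = u ∨ z = v)
    (hu : ∀ z, G.Adj u z ↔ z = x ∨ z = y) (hv : ∀ z, G.Adj v z ↔ z = x ∨ z = y) :
    Nonempty (G ≃g graphG3) := by
  have hirr : ∀ x, ¬ G.Adj x x := fun x => G.irrefl
  have := (hs _).not.1 (hirr s)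
  have := (hx _).not.1 (hirr x)
  have := (hy _).not.1 (hirr y)
  have := (hu _).not.1 (hirr u)
  have := (hv _).not.1 (hirr v)
  have := hl x
  have := hu x
  have := hv x
  refine nonempty_iso_of_injective hG ![x, y, u, v, s, l] ?_ ?_ ?_
  · intro i j
    fin_cases i <;> fin_cases j <;> simp <;> grind only
  · intro i j
    fin_cases i <;> fin_cases j <;> simp [graphG3, hs, hl, hx, hy, hu, hv]
  · intro i
    fin_cases i <;> simp [graphG3, hs, hl, hx, hy, hu, hv, Fin.exists_fin_succ]

lemma nonempty_iso_doubleStar22 {V : Type*} {G : SimpleGraph V}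
    (hG : ∀ A : Set V, A.Nonempty → (∀ a ∈ A, ∀ b, G.Adj a b → b ∈ A) → A = Set.univ)
    {s t l m p q : V} (hlm : l ≠ m) (hlt : l ≠ t) (hmt : m ≠ t) (hpq : p ≠ q) (hps : p ≠ s)
    (hqs : q ≠ s)
    (hs : ∀ z, G.Adj s z ↔ z = l ∨ z = m ∨ z = t) (ht : ∀ z, G.Adj t z ↔ z = s ∨ z = p ∨ z = q)
    (hl : ∀ z, G.Adj l z ↔ z = s) (hm : ∀ z, G.Adj m z ↔ z = s)
    (hp : ∀ z, G.Adj p z ↔ z = t) (hq : ∀ z, G.Adj q z ↔ z = t) :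
    Nonempty (G ≃g doubleStar22) := by
  have hirr : ∀ x, ¬ G.Adj x x := fun x => G.irrefl
  have := (hs _).not.1 (hirr s)
  have := (ht _).not.1 (hirr t)
  have := (hp _).not.1 (hirr p)
  have := (hq _).not.1 (hirr q)
  have := hl s
  have := hm s
  have := hp s
  have := hq s
  refine nonempty_iso_of_injective hG ![s, t, l, m, p, q] ?_ ?_ ?_
  · intro i j
    fin_cases i <;> fin_cases j <;> simp <;> grind only
  · intro i j
    fin_cases i <;> fin_cases j <;> simp [doubleStar22, hs, hl, hm, ht, hp, hq]
  · intro i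
    fin_cases i <;> simp [doubleStar22, hs, hl, hm, ht, hp, hq, Fin.exists_fin_succ]

lemma nonempty_iso_graphG5 {V : Type*} {G : SimpleGraph V}
    (hG : ∀ A : Set V, A.Nonempty → (∀ a ∈ A, ∀ b, G.Adj a b → b ∈ A) → A = Set.univ)
    {a b c d e f : V} (hac : a ≠ c) (hae : a ≠ e) (hce : c ≠ e) (hbd : b ≠ d) (hbf : b ≠ f)
    (hdf : d ≠ f)
    (ha : ∀ z, G.Adj a z ↔ z = b) (hb : ∀ z, G.Adj b z ↔ z = a ∨ z = c ∨ z = e)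
    (hc : ∀ z, G.Adj c z ↔ z = b ∨ z = d) (hd : ∀ z, G.Adj d z ↔ z = c ∨ z = e)
    (he : ∀ z, G.Adj e z ↔ z = b ∨ z = d ∨ z = f) (hf : ∀ z, G.Adj f z ↔ z = e) :
    Nonempty (G ≃g graphG5) := by
  have hirr : ∀ x, ¬ G.Adj x x := fun x => G.irrefl
  have := (ha _).not.1 (hirr a)
  have := (hb _).not.1 (hirr b)
  have := (hc _).not.1 (hirr c)
  have := (hd _).not.1 (hirr d)
  have := (he _).not.1 (hirr e)
  have := (hf _).not.1 (hirr f)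
  have := ha c
  have := hd c
  have := ha b
  have := hc b
  have := hf b
  refine nonempty_iso_of_injective hG ![a, b, c, d, e, f] ?_ ?_ ?_
  · intro i j
    fin_cases i <;> fin_cases j <;> simp <;> grind only
  · intro i j
    fin_cases i <;> fin_cases j <;> simp [graphG5, ha, hb, hc, hd, he, hf]
  · intro i
    fin_cases i <;> simp [graphG5, ha, hb, hc, hd, he, hf, Fin.exists_fin_succ]

lemma adj_iff_of_ncard_le_three {V : Type*} [Finite V] {G : SimpleGraph V} {v a b c : V}
    (hv : (G.neighborSet v).ncard ≤ 3) (ha : G.Adj a v) (hb : G.Adj b v) (hc : G.Adj c v)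
    (hab : a ≠ b) (hac : a ≠ c) (hbc : b ≠ c) (x : V) :
    G.Adj v x ↔ x = a ∨ x = b ∨ x = c := by
  refine ⟨eq_or_eq_or_eq_of_adj hv ha.symm hb.symm hc.symm hab hac hbc x, ?_⟩
  rintro (rfl | rfl | rfl)
  exacts [ha.symm, hb.symm, hc.symm]

lemma adj_iff_or_of_forall_adj {V : Type*} {G : SimpleGraph V} (hiso : ∀ v, ∃ u, G.Adj v u)
    {w a b : V} (hw : ∀ x, G.Adj w x → x = a ∨ x = b) :
    (∀ x, G.Adj w x ↔ x = a) ∨ (∀ x, G.Adj w x ↔ x = b) ∨ ∀ x, G.Adj w x ↔ x = a ∨ x = b := by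
  obtain ⟨u, hu⟩ := hiso w
  by_cases ha : G.Adj w a <;> by_cases hb : G.Adj w b <;> grind

lemma exists_of_adj_two {V : Type*} [Finite V] {G : SimpleGraph V} {v a b : V}
    (hle : (G.neighborSet v).ncard ≤ (nbrSubset G v).ncard + 1)
    (hab : a ≠ b) (h : ∀ x, G.Adj v x ↔ x = a ∨ x = b) :
    ∃ w, w ≠ v ∧ ∀ x, G.Adj w x → x = a ∨ x = b := by
  have h2 : (G.neighborSet v).ncard = 2 := Set.ncard_eq_two.2 ⟨a, b, hab, by ext; simp [h]⟩
  obtain ⟨w, hwv, hw⟩ := (Set.ncard_pos).1 (show 0 < (nbrSubset G v).ncard by omega)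
  exact ⟨w, hwv, fun x hx => (h x).1 (hw x hx)⟩

lemma exists_pair_of_adj_three {V : Type*} [Finite V] {G : SimpleGraph V} {v a b c : V}
    (hle : (G.neighborSet v).ncard ≤ (nbrSubset G v).ncard + 1)
    (hab : a ≠ b) (hac : a ≠ c) (hbc : b ≠ c) (h : ∀ x, G.Adj v x ↔ x = a ∨ x = b ∨ x = c) :
    ∃ w w', w ≠ v ∧ w' ≠ v ∧ w ≠ w' ∧ (∀ x, G.Adj w x → x = a ∨ x = b ∨ x = c) ∧
      ∀ x, G.Adj w' x → x = a ∨ x = b ∨ x = c := by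
  have h3 : (G.neighborSet v).ncard = 3 :=
    Set.ncard_eq_three.2 ⟨a, b, c, hab, hac, hbc, by ext; simp [h]⟩
  obtain ⟨w, ⟨hwv, hw⟩, w', ⟨hwv', hw'⟩, hww⟩ :=
    exists_pair_of_two_le_ncard (show 2 ≤ (nbrSubset G v).ncard by omega)
  exact ⟨w, w', hwv, hwv', hww, fun x hx => (h x).1 (hw x hx), fun x hx => (h x).1 (hw' x hx)⟩

/-- A leaf exists as soon as some vertex `w` of degree two has its two neighbours among the
neighbours of a vertex `v ≠ w` of larger degree. -/
lemma exists_leaf_of_twins {V : Type*} [Finite V] {G : SimpleGraph V}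
    (hsub : ∀ v, (G.neighborSet v).ncard ≤ 3)
    (hiso : ∀ v, ∃ u, G.Adj v u)
    (hle : ∀ v, (G.neighborSet v).ncard ≤ (nbrSubset G v).ncard + 1)
    {v w p q : V} (hwv : w ≠ v) (hpq : p ≠ q) (hvp : G.Adj v p) (hvq : G.Adj v q)
    (hvw : ∃ x, G.Adj v x ∧ x ≠ p ∧ x ≠ q)
    (hw : ∀ x, G.Adj w x ↔ x = p ∨ x = q) : ∃ l s, ∀ x, G.Adj l x ↔ x = s := by
  by_contra! hleaf
  replace hleaf : ∀ l s, ¬ ∀ x, G.Adj l x ↔ x = s := fun l s h => by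
    obtain ⟨x, hx⟩ := hleaf l s
    have := h x
    tauto
  obtain ⟨x, hxw, hx⟩ := exists_of_adj_two (hle w) hpq hw
  have hx := ((adj_iff_or_of_forall_adj hiso hx).resolve_left (hleaf _ _)).resolve_left
    (hleaf _ _)
  have hxv : x ≠ v := by grind
  have hp := adj_iff_of_ncard_le_three (hsub p) hvp ((hw p).2 (Or.inl rfl))
    ((hx p).2 (Or.inl rfl)) hwv.symm hxv.symm hxw.symm
  have hq := adj_iff_of_ncard_le_three (hsub q) hvq ((hw q).2 (Or.inr rfl))
    ((hx q).2 (Or.inr rfl)) hwv.symm hxv.symm hxw.symm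
  have honly : ∀ y, y ≠ p → (∀ z, G.Adj y z → z = v ∨ z = w ∨ z = x) → y = q := by
    intro y hyp hy
    by_contra hyq
    have hyw : ¬ G.Adj y w := fun h => by grind [h.symm]
    have hyx : ¬ G.Adj y x := fun h => by grind [h.symm]
    obtain ⟨u, hu⟩ := hiso y
    exact hleaf y v fun z => by grind
  obtain ⟨y, y', hyp, hyp', hyy, hy, hy'⟩ :=
    exists_pair_of_adj_three (hle p) hwv.symm hxv.symm hxw.symm hp
  exact hyy ((honly y hyp hy).trans (honly y' hyp' hy').symm)

lemma nonempty_iso_of_forall_not_leaf {V : Type*} [Finite V] [Nonempty V] {G : SimpleGraph V}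
    (hG : ∀ A : Set V, A.Nonempty → (∀ a ∈ A, ∀ b, G.Adj a b → b ∈ A) → A = Set.univ)
    (hsub : ∀ v, (G.neighborSet v).ncard ≤ 3)
    (hiso : ∀ v, ∃ u, G.Adj v u)
    (hle : ∀ v, (G.neighborSet v).ncard ≤ (nbrSubset G v).ncard + 1)
    (hleaf : ∀ l s, ¬ ∀ x, G.Adj l x ↔ x = s) :
    Nonempty (G ≃g completeBipartiteGraph (Fin 2) (Fin 2)) ∨
      Nonempty (G ≃g completeBipartiteGraph (Fin 3) (Fin 3)) := by
  by_cases h3 : ∃ v a b c, a ≠ b ∧ a ≠ c ∧ b ≠ c ∧ ∀ x, G.Adj v x ↔ x = a ∨ x = b ∨ x = c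
  · right
    obtain ⟨v, a, b, c, hab, hac, hbc, hv⟩ := h3
    obtain ⟨w, w', hwv, hwv', hww, hw, hw'⟩ := exists_pair_of_adj_three (hle v) hab hac hbc hv
    have hfull : ∀ w, w ≠ v → (∀ x, G.Adj w x → x = a ∨ x = b ∨ x = c) →
        ∀ x, G.Adj w x ↔ x = a ∨ x = b ∨ x = c := by
      intro w hwv hw
      rcases neighborSet_cases (hsub w) (hiso w) with ⟨-, p, h⟩ | ⟨-, p, q, hpq, h⟩ |
        ⟨-, p, q, r, hpq, hpr, hqr, h⟩
      · exact absurd h (hleaf w p)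
      · obtain ⟨l, s, hl⟩ := exists_leaf_of_twins hsub hiso hle hwv hpq
          ((hv p).2 (hw p ((h p).2 (Or.inl rfl)))) ((hv q).2 (hw q ((h q).2 (Or.inr rfl))))
          (by have := (hv a).2; have := (hv b).2; have := (hv c).2; grind) h
        exact absurd hl (hleaf l s)
      · have := hw p; have := hw q; have := hw r
        have := (h p).2; have := (h q).2; have := (h r).2
        grind
    have hw := hfull w hwv hw
    have hw' := hfull w' hwv' hw'
    have hN : ∀ x, x = a ∨ x = b ∨ x = c → ∀ y, G.Adj x y ↔ y = v ∨ y = w ∨ y = w' :=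
      fun x hx => adj_iff_of_ncard_le_three (hsub x) ((hv x).2 hx) ((hw x).2 hx) ((hw' x).2 hx)
        hwv.symm hwv'.symm hww
    exact nonempty_iso_K33 hG hwv.symm hwv'.symm hww hab hac hbc hv hw hw'
      (hN a (by simp)) (hN b (by simp)) (hN c (by simp))
  · left
    have h2 : ∀ v, ∃ a b, a ≠ b ∧ ∀ x, G.Adj v x ↔ x = a ∨ x = b := by
      intro v
      rcases neighborSet_cases (hsub v) (hiso v) with ⟨-, a, h⟩ | ⟨-, h⟩ | ⟨-, h⟩
      · exact absurd h (hleaf v a)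
      · exact h
      · exact absurd ⟨v, h⟩ h3
    obtain ⟨v⟩ := ‹Nonempty V›
    obtain ⟨a, b, hab, hv⟩ := h2 v
    obtain ⟨w, hwv, hw⟩ := exists_of_adj_two (hle v) hab hv
    have hw := ((adj_iff_or_of_forall_adj hiso hw).resolve_left (hleaf _ _)).resolve_left
      (hleaf _ _)
    have hN : ∀ x, x = a ∨ x = b → ∀ y, G.Adj x y ↔ y = v ∨ y = w := by
      intro x hx
      obtain ⟨p, q, hpq, h⟩ := h2 x
      have h1 := (h v).1 ((hv x).2 hx).symm
      have h1' := (h w).1 ((hw x).2 hx).symm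
      grind
    exact nonempty_iso_K22 hG hwv.symm hab hv hw (hN a (by simp)) (hN b (by simp))

/-- The exceptional graph arising at a support vertex `s` with neighbours `l`, `x`, `y`, where `l`
is a leaf and `y` neither is a leaf nor has a leaf. -/
lemma nonempty_iso_of_support {V : Type*} [Finite V] {G : SimpleGraph V}
    (hG : ∀ A : Set V, A.Nonempty → (∀ a ∈ A, ∀ b, G.Adj a b → b ∈ A) → A = Set.univ)
    (hsub : ∀ v, (G.neighborSet v).ncard ≤ 3)
    (hiso : ∀ v, ∃ u, G.Adj v u)
    (hle : ∀ v, (G.neighborSet v).ncard ≤ (nbrSubset G v).ncard + 1)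
    {s l x y : V} (hlx : l ≠ x) (hly : l ≠ y) (hxy : x ≠ y)
    (hs : ∀ z, G.Adj s z ↔ z = l ∨ z = x ∨ z = y) (hl : ∀ z, G.Adj l z ↔ z = s)
    (hys : ¬ ∀ z, G.Adj y z ↔ z = s) (hyl : ∀ m, ¬ ∀ z, G.Adj m z ↔ z = y)
    {w w' : V} (hws : w ≠ s) (hws' : w' ≠ s) (hww : w ≠ w')
    (hw : ∀ z, G.Adj w z → z = x ∨ z = y) (hw' : ∀ z, G.Adj w' z → z = x ∨ z = y) :
    Nonempty (G ≃g graphG3) ∨ Nonempty (G ≃g graphG5) := by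
  have hsx : G.Adj s x := (hs x).2 (by simp)
  have hsy : G.Adj s y := (hs y).2 (by simp)
  have hcase : ∀ w, (∀ z, G.Adj w z → z = x ∨ z = y) →
      (∀ z, G.Adj w z ↔ z = x) ∨ ∀ z, G.Adj w z ↔ z = x ∨ z = y := by
    intro w hw
    have := adj_iff_or_of_forall_adj hiso hw
    have := hyl w
    tauto
  have hx : ∀ z, G.Adj x z ↔ z = s ∨ z = w ∨ z = w' := by
    have hadj : ∀ w, (∀ z, G.Adj w z → z = x ∨ z = y) → G.Adj w x := fun w hw => by
      rcases hcase w hw with h | h <;> simp [h]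
    exact adj_iff_of_ncard_le_three (hsub x) hsx (hadj w hw) (hadj w' hw') hws.symm hws'.symm hww
  obtain ⟨z, z', hzx, hzx', hzz, hz, hz'⟩ := exists_pair_of_adj_three (hle x) hws.symm hws'.symm
    hww hx
  have hzl : ∀ z, z ≠ x → z ≠ y → (∀ u, G.Adj z u → u = s ∨ u = w ∨ u = w') → z = l := by
    intro z hzx hzy hz
    have hzw : ¬ G.Adj z w := fun h => (hw z h.symm).elim hzx hzy
    have hzw' : ¬ G.Adj z w' := fun h => (hw' z h.symm).elim hzx hzy
    obtain ⟨u, hu⟩ := hiso z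
    rcases hz u hu with rfl | rfl | rfl
    · exact ((hs z).1 hu.symm).resolve_right (by tauto)
    · exact absurd hu hzw
    · exact absurd hu hzw'
  have hy : ∀ u, G.Adj y u → u = s ∨ u = w ∨ u = w' := by
    by_contra hy
    have hzy : z ≠ y := fun h => hy (h ▸ hz)
    have hzy' : z' ≠ y := fun h => hy (h ▸ hz')
    exact hzz ((hzl z hzx hzy hz).trans (hzl z' hzx' hzy' hz').symm)
  have hyw : ∀ w, (∀ z, G.Adj w z ↔ z = x) → ¬ G.Adj y w := fun w hw h =>
    hxy ((hw y).1 h.symm).symm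
  rcases hcase w hw with h | h <;> rcases hcase w' hw' with h' | h'
  · refine absurd (fun u => ⟨fun hu => ?_, ?_⟩) hys
    · rcases hy u hu with rfl | rfl | rfl
      exacts [rfl, absurd hu (hyw _ h), absurd hu (hyw _ h')]
    · rintro rfl
      exact hsy.symm
  · right
    have hy' : ∀ u, G.Adj y u ↔ u = s ∨ u = w' := by
      refine fun u => ⟨fun hu => ?_, ?_⟩
      · rcases hy u hu with rfl | rfl | rfl
        exacts [Or.inl rfl, absurd hu (hyw _ h), Or.inr rfl]
      · rintro (rfl | rfl)
        exacts [hsy.symm, ((h' y).2 (Or.inr rfl)).symm]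
    refine nonempty_iso_graphG5 hG hly hlx hxy.symm hws'.symm hws.symm hww.symm hl
      (fun z => ?_) hy' (fun z => ?_) (fun z => ?_) h
    · rw [hs, or_comm (a := z = x)]
    · rw [h', or_comm]
    · rw [hx, or_comm (a := z = w)]
  · right
    have hy' : ∀ u, G.Adj y u ↔ u = s ∨ u = w := by
      refine fun u => ⟨fun hu => ?_, ?_⟩
      · rcases hy u hu with rfl | rfl | rfl
        exacts [Or.inl rfl, Or.inr rfl, absurd hu (hyw _ h')]
      · rintro (rfl | rfl)
        exacts [hsy.symm, ((h y).2 (Or.inr rfl)).symm]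
    refine nonempty_iso_graphG5 hG hly hlx hxy.symm hws.symm hws'.symm hww hl
      (fun z => ?_) hy' (fun z => ?_) hx h'
    · rw [hs, or_comm (a := z = x)]
    · rw [h, or_comm]
  · left
    have hy := adj_iff_of_ncard_le_three (hsub y) hsy ((h y).2 (by simp)) ((h' y).2 (by simp))
      hws.symm hws'.symm hww
    exact nonempty_iso_graphG3 hG hlx hly hxy hws.symm hws'.symm hww hs hl hx hy h h'

lemma nonempty_iso_corona_of_leaf {V : Type*} [Finite V] {G : SimpleGraph V}
    (hG : ∀ A : Set V, A.Nonempty → (∀ a ∈ A, ∀ b, G.Adj a b → b ∈ A) → A = Set.univ)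
    (hsub : ∀ v, (G.neighborSet v).ncard ≤ 3)
    (hiso : ∀ v, ∃ u, G.Adj v u)
    (hle : ∀ v, (G.neighborSet v).ncard ≤ (nbrSubset G v).ncard + 1)
    (hG3 : ¬ Nonempty (G ≃g graphG3)) (hS22 : ¬ Nonempty (G ≃g doubleStar22))
    (hG5 : ¬ Nonempty (G ≃g graphG5))
    {l₀ s₀ : V} (hl₀ : ∀ x, G.Adj l₀ x ↔ x = s₀) :
    (∃ k, 1 ≤ k ∧ Nonempty (G ≃g corona (pathGraph k))) ∨
      ∃ k, 3 ≤ k ∧ Nonempty (G ≃g corona (cycleGraph k)) := by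
  have hsl₀ : G.Adj s₀ l₀ := ((hl₀ s₀).2 rfl).symm
  by_cases hs₀ : ∃ t, ∀ x, G.Adj s₀ x ↔ x = t
  · obtain ⟨t, ht⟩ := hs₀
    obtain rfl := (ht l₀).1 hsl₀
    refine nonempty_iso_corona G hG hsub {s₀} ⟨s₀, rfl⟩ ?_
    rintro _ rfl
    exact ⟨l₀, hsl₀.ne', hl₀, fun x hx => Or.inl ((ht x).1 hx)⟩
  · refine nonempty_iso_corona G hG hsub
      {s | (∃ l, ∀ x, G.Adj l x ↔ x = s) ∧ ¬ ∃ t, ∀ x, G.Adj s x ↔ x = t} ⟨s₀, ⟨l₀, hl₀⟩, hs₀⟩ ?_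
    rintro s ⟨⟨l, hl⟩, hs⟩
    have hsl : G.Adj s l := ((hl s).2 rfl).symm
    have hwl : ∀ w, w ≠ s → ¬ G.Adj w l := fun w hws h => hws ((hl w).1 h.symm)
    suffices h : ∀ x, G.Adj s x → x ≠ l →
        (∃ m, ∀ z, G.Adj m z ↔ z = x) ∧ ¬ ∃ t, ∀ z, G.Adj x z ↔ z = t from
      ⟨l, fun h => h.2 ⟨s, hl⟩, hl, fun x hx => (em (x = l)).imp id (h x hx)⟩
    have hleaf : ∀ x, G.Adj s x → (∃ t, ∀ z, G.Adj x z ↔ z = t) → ∀ z, G.Adj x z ↔ z = s := by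
      rintro x hsx ⟨t, ht⟩
      rwa [← (ht s).1 hsx.symm] at ht
    rcases neighborSet_cases (hsub s) (hiso s) with ⟨-, h⟩ | ⟨-, a, b, hab, h⟩ |
      ⟨-, a, b, c, hab, hac, hbc, h⟩
    · exact absurd h hs
    · obtain ⟨w, hws, hw⟩ := exists_of_adj_two (hle s) hab h
      have := hwl w hws
      intro x hx hxl
      have hw' : ∀ z, G.Adj w z ↔ z = x := by
        have hw' : ∀ z, G.Adj w z → z = x := by
          intro z hz
          have := hw z hz
          have := (h x).1 hx
          have := (h l).1 hsl
          grind
        obtain ⟨u, hu⟩ := hiso w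
        obtain rfl := hw' u hu
        exact fun z => ⟨hw' z, by rintro rfl; exact hu⟩
      exact ⟨⟨w, hw'⟩, fun hx' => hws ((hleaf x hx hx' w).1 ((hw' x).2 rfl).symm)⟩
    · obtain ⟨w, w', hws, hws', hww, hw, hw'⟩ := exists_pair_of_adj_three (hle s) hab hac hbc h
      obtain ⟨x, y, hlx, hly, hxy, hN⟩ : ∃ x y, l ≠ x ∧ l ≠ y ∧ x ≠ y ∧
          ∀ z, G.Adj s z ↔ z = l ∨ z = x ∨ z = y := by
        rcases (h l).1 hsl with rfl | rfl | rfl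
        · exact ⟨b, c, hab, hac, hbc, h⟩
        · exact ⟨a, c, hab.symm, hbc, hac, fun z => by rw [h]; tauto⟩
        · exact ⟨a, b, hac.symm, hbc.symm, hab, fun z => by rw [h]; tauto⟩
      have hwN : ∀ w, w ≠ s → (∀ z, G.Adj w z → G.Adj s z) → ∀ z, G.Adj w z → z = x ∨ z = y :=
        fun w hws hw z hz => ((hN z).1 (hw z hz)).resolve_left (by
          rintro rfl
          exact hwl w hws hz)
      have key : ∀ x y, l ≠ x → l ≠ y → x ≠ y → (∀ z, G.Adj s z ↔ z = l ∨ z = x ∨ z = y) →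
          (∀ z, G.Adj w z → z = x ∨ z = y) → (∀ z, G.Adj w' z → z = x ∨ z = y) →
          (∃ m, ∀ z, G.Adj m z ↔ z = y) ∧ ¬ ∃ t, ∀ z, G.Adj y z ↔ z = t := by
        intro x y hlx hly hxy hN hw hw'
        have hsy : G.Adj s y := (hN y).2 (by simp)
        have hnot : ∀ x y, l ≠ x → l ≠ y → x ≠ y → (∀ z, G.Adj s z ↔ z = l ∨ z = x ∨ z = y) →
            (∀ z, G.Adj w z → z = x ∨ z = y) → (∀ z, G.Adj w' z → z = x ∨ z = y) →
            ¬ ∀ z, G.Adj x z ↔ z = s := by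
          intro x y hlx hly hxy hN hw hw' hx
          have hsy : G.Adj s y := (hN y).2 (by simp)
          have hpend : ∀ w, w ≠ s → (∀ z, G.Adj w z → z = x ∨ z = y) → ∀ z, G.Adj w z ↔ z = y := by
            intro w hws hw
            have hw' : ∀ z, G.Adj w z → z = y := fun z hz => (hw z hz).resolve_left (by
              rintro rfl
              exact hws ((hx w).1 hz.symm))
            obtain ⟨u, hu⟩ := hiso w
            obtain rfl := hw' u hu
            exact fun z => ⟨hw' z, by rintro rfl; exact hu⟩
          have hw := hpend w hws hw
          have hw' := hpend w' hws' hw'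
          have hy := adj_iff_of_ncard_le_three (hsub y) hsy ((hw y).2 rfl) ((hw' y).2 rfl)
            hws.symm hws'.symm hww
          exact hS22 (nonempty_iso_doubleStar22 hG hlx hly hxy hww hws hws' hN hy hl hx hw hw')
        have hys : ¬ ∀ z, G.Adj y z ↔ z = s :=
          hnot y x hly hlx hxy.symm (fun z => by rw [hN]; tauto) (fun z hz => (hw z hz).symm)
            fun z hz => (hw' z hz).symm
        refine ⟨?_, fun ht => hys (hleaf y hsy ht)⟩
        by_contra hyl
        exact (nonempty_iso_of_support hG hsub hiso hle hlx hly hxy hN hl hys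
          (fun m hm => hyl ⟨m, hm⟩) hws hws' hww hw hw').elim hG3 hG5
      have hw := hwN w hws fun z hz => (h z).2 (hw z hz)
      have hw' := hwN w' hws' fun z hz => (h z).2 (hw' z hz)
      intro z hz hzl
      rcases ((hN z).1 hz).resolve_left hzl with rfl | rfl
      · exact key y z hly hlx hxy.symm (fun u => by rw [hN]; tauto) (fun u hu => (hw u hu).symm)
          fun u hu => (hw' u hu).symm
      · exact key x z hlx hly hxy hN hw hw'

/-- Characterization of the connected subcubic graphs `G` of order `n ≥ 2`
(with no isolated vertex) satisfying `i(G) = n/2`: the five exceptional graphs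
`K_{2,2}`, `K_{3,3}`, `G₃`, `S(2,2)`, `G₅`, the coronas of paths, and the
coronas of cycles. -/
theorem stmt_9 {V : Type*} [Fintype V] (G : SimpleGraph V)
    (hconn : G.Connected) (hn : 2 ≤ Fintype.card V)
    (hsub : ∀ v : V, Nat.card (G.neighborSet v) ≤ 3)
    (hiso : ∀ v : V, ∃ u, G.Adj v u) :
    2 * indepDomNum G = Fintype.card V ↔
      ((Nonempty (G ≃g completeBipartiteGraph (Fin 2) (Fin 2)) ∨
        Nonempty (G ≃g completeBipartiteGraph (Fin 3) (Fin 3)) ∨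
        Nonempty (G ≃g graphG3) ∨
        Nonempty (G ≃g doubleStar22) ∨
        Nonempty (G ≃g graphG5)) ∨
       (∃ k, 1 ≤ k ∧ Fintype.card V = 2 * k ∧
          Nonempty (G ≃g corona (pathGraph k))) ∨
       (∃ k, 3 ≤ k ∧ Fintype.card V = 2 * k ∧
          Nonempty (G ≃g corona (cycleGraph k)))) := by
  replace hsub : ∀ v, (G.neighborSet v).ncard ≤ 3 := fun v => by
    simpa [Nat.card_coe_set_eq] using hsub v
  constructor
  · intro htight
    have hle := ncard_neighborSet_le_nbrSubset G hsub htight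
    have hG : ∀ A : Set V, A.Nonempty → (∀ a ∈ A, ∀ b, G.Adj a b → b ∈ A) → A = Set.univ :=
      fun A hA hcl => hconn.eq_univ_of_closed A hA hcl
    have := hconn.nonempty
    by_cases hleaf : ∃ l s, ∀ x, G.Adj l x ↔ x = s
    · obtain ⟨l, s, hl⟩ := hleaf
      by_cases hG3 : Nonempty (G ≃g graphG3)
      · exact Or.inl (Or.inr (Or.inr (Or.inl hG3)))
      by_cases hS22 : Nonempty (G ≃g doubleStar22)
      · exact Or.inl (Or.inr (Or.inr (Or.inr (Or.inl hS22))))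
      by_cases hG5 : Nonempty (G ≃g graphG5)
      · exact Or.inl (Or.inr (Or.inr (Or.inr (Or.inr hG5))))
      have hcard : ∀ {k : ℕ} {H : SimpleGraph (Fin k)}, Nonempty (G ≃g corona H) →
          Fintype.card V = 2 * k := by
        rintro k H ⟨e⟩
        rw [Fintype.card_congr e.toEquiv]
        simp [mul_comm]
      exact Or.inr ((nonempty_iso_corona_of_leaf hG hsub hiso hle hG3 hS22 hG5 hl).imp
        (fun ⟨k, hk, e⟩ => ⟨k, hk, hcard e, e⟩) fun ⟨k, hk, e⟩ => ⟨k, hk, hcard e, e⟩)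
    · push Not at hleaf
      have := nonempty_iso_of_forall_not_leaf hG hsub hiso hle fun l s h => by
        obtain ⟨x, hx⟩ := hleaf l s
        have := h x
        tauto
      exact Or.inl (this.imp id Or.inl)
  · rintro ((⟨⟨e⟩⟩ | ⟨⟨e⟩⟩ | ⟨⟨e⟩⟩ | ⟨⟨e⟩⟩ | ⟨⟨e⟩⟩) | ⟨k, -, -, ⟨e⟩⟩ | ⟨k, -, -, ⟨e⟩⟩)
    · exact two_mul_indepDomNum_eq G hsub hiso e isIndepDomSet_K22
    · exact two_mul_indepDomNum_eq G hsub hiso e isIndepDomSet_K33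
    · exact two_mul_indepDomNum_eq G hsub hiso e isIndepDomSet_graphG3
    · exact two_mul_indepDomNum_eq G hsub hiso e isIndepDomSet_doubleStar22
    · exact two_mul_indepDomNum_eq G hsub hiso e isIndepDomSet_graphG5
    · exact two_mul_indepDomNum_eq G hsub hiso e (isIndepDomSet_corona _)
    · exact two_mul_indepDomNum_eq G hsub hiso e (isIndepDomSet_corona _)
end

section
/- Let G be a connected subcubic graph of even order n ≥ 6 with i(G) = n/2. If G contains no support vertex (equivalently, G has minimum degree at least 2), then G is isomorphic to the complete bipartite graph K_{3,3}. -/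
open SimpleGraph

/-- A minimum independent dominating set `A` occupying half of the vertices of a graph
all of whose degrees are `2` or `3`. -/
structure IsHalfMinimum {V : Type*} [Fintype V] [DecidableEq V] (G : SimpleGraph V)
    [DecidableRel G.Adj] (A : Finset V) : Prop where
  dom : ∀ v ∉ A, ∃ u ∈ A, G.Adj u v
  ind : ∀ u ∈ A, ∀ v ∈ A, ¬ G.Adj u v
  min : ∀ S : Finset V, (∀ v ∉ S, ∃ u ∈ S, G.Adj u v) → (∀ u ∈ S, ∀ v ∈ S, ¬ G.Adj u v) →
    A.card ≤ S.card
  card : 2 * A.card = Fintype.card V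
  two_le : ∀ v, 2 ≤ G.degree v
  le_three : ∀ v, G.degree v ≤ 3

/-- The vertices outside `A` with exactly `k` neighbours in `A`. -/
def level {V : Type*} [Fintype V] [DecidableEq V] (G : SimpleGraph V) [DecidableRel G.Adj]
    (A : Finset V) (k : ℕ) : Finset V :=
  {v | v ∉ A ∧ (G.neighborFinset v ∩ A).card = k}

/-- `G` contains a copy of `K_{3,3}` with one side in `A` and the other outside `A`. -/
def HasK33 {V : Type*} (G : SimpleGraph V) (A : Finset V) : Prop :=
  ∃ x y z a b c : V, x ∉ A ∧ y ∉ A ∧ z ∉ A ∧ a ∈ A ∧ b ∈ A ∧ c ∈ A ∧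
    x ≠ y ∧ x ≠ z ∧ y ≠ z ∧ a ≠ b ∧ a ≠ c ∧ b ≠ c ∧
    G.Adj x a ∧ G.Adj x b ∧ G.Adj x c ∧ G.Adj y a ∧ G.Adj y b ∧ G.Adj y c ∧
    G.Adj z a ∧ G.Adj z b ∧ G.Adj z c

/-- The charge that a vertex of `A` sends to each of its neighbours in `level G A 3`. -/
def charge {V : Type*} [Fintype V] [DecidableEq V] (G : SimpleGraph V) [DecidableRel G.Adj]
    (A : Finset V) (a : V) : ℕ :=
  if 0 < (G.neighborFinset a ∩ level G A 1).card ∨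
    (G.degree a = 3 ∧ (G.neighborFinset a ∩ level G A 3).card = 1) then 1 else 0

/-- `u, p, u', q` is a four-cycle whose vertices `p, q ∈ A` have no further neighbours and whose
vertices `u, u' ∉ A` have no further neighbours in `A`. -/
structure IsSquareBlock {V : Type*} (G : SimpleGraph V) (A : Finset V) (u u' p q : V) : Prop where
  left_notMem : u ∉ A
  right_notMem : u' ∉ A
  left_mem : p ∈ A
  right_mem : q ∈ A
  ne : u ≠ u'
  ne' : p ≠ q
  not_adj : ¬ G.Adj u u'
  adj_up : G.Adj u p
  adj_uq : G.Adj u q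
  adj_up' : G.Adj u' p
  adj_uq' : G.Adj u' q
  nbr_u : ∀ x ∈ A, G.Adj u x → x = p ∨ x = q
  nbr_u' : ∀ x ∈ A, G.Adj u' x → x = p ∨ x = q
  nbr_p : ∀ x, G.Adj p x → x = u ∨ x = u'
  nbr_q : ∀ x, G.Adj q x → x = u ∨ x = u'

/-- `{v, v'}` and `{a, b, c}` span a `K_{2,3}` attached to the rest of the graph only through the
edge `aw`, and `a` is the only neighbour of `w` in `A`. -/
structure IsPendantBlock {V : Type*} (G : SimpleGraph V) (A : Finset V) (v v' w a b c : V) :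
    Prop where
  v_notMem : v ∉ A
  v_notMem' : v' ∉ A
  w_notMem : w ∉ A
  a_mem : a ∈ A
  b_mem : b ∈ A
  c_mem : c ∈ A
  v_ne : v ≠ v'
  w_ne : w ≠ v
  w_ne' : w ≠ v'
  ab_ne : a ≠ b
  ac_ne : a ≠ c
  bc_ne : b ≠ c
  adj_va : G.Adj v a
  adj_vb : G.Adj v b
  adj_vc : G.Adj v c
  adj_va' : G.Adj v' a
  adj_vb' : G.Adj v' b
  adj_vc' : G.Adj v' c
  adj_wa : G.Adj w a
  nbr_v : ∀ x, G.Adj v x → x = a ∨ x = b ∨ x = c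
  nbr_v' : ∀ x, G.Adj v' x → x = a ∨ x = b ∨ x = c
  nbr_w : ∀ x ∈ A, G.Adj w x → x = a
  nbr_a : ∀ x, G.Adj a x → x = v ∨ x = v' ∨ x = w
  nbr_b : ∀ x, G.Adj b x → x = v ∨ x = v'
  nbr_c : ∀ x, G.Adj c x → x = v ∨ x = v'

theorem IsSquareBlock.symm {V : Type*} {G : SimpleGraph V} {A : Finset V} {u u' p q : V}
    (h : IsSquareBlock G A u u' p q) : IsSquareBlock G A u' u p q :=
  { left_notMem := h.right_notMem
    right_notMem := h.left_notMem
    left_mem := h.left_mem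
    right_mem := h.right_mem
    ne := h.ne.symm
    ne' := h.ne'
    not_adj := fun hadj => h.not_adj hadj.symm
    adj_up := h.adj_up'
    adj_uq := h.adj_uq'
    adj_up' := h.adj_up
    adj_uq' := h.adj_uq
    nbr_u := h.nbr_u'
    nbr_u' := h.nbr_u
    nbr_p := fun x hx => (h.nbr_p x hx).symm
    nbr_q := fun x hx => (h.nbr_q x hx).symm }

section

variable {V : Type*} [Fintype V] [DecidableEq V] {G : SimpleGraph V} [DecidableRel G.Adj]
  {A : Finset V}

theorem degree_two_cases {v a b : V} (h : G.degree v = 2) (ha : G.Adj v a) (hb : G.Adj v b)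
    (hab : a ≠ b) {x : V} (hx : G.Adj v x) : x = a ∨ x = b := by
  have hs : ({a, b} : Finset V) = G.neighborFinset v := by
    apply Finset.eq_of_subset_of_card_le
    · intro y hy
      simp only [Finset.mem_insert, Finset.mem_singleton] at hy
      rw [mem_neighborFinset]
      grind
    · rw [card_neighborFinset_eq_degree, h, Finset.card_pair hab]
  have : x ∈ ({a, b} : Finset V) := by rw [hs]; simpa using hx
  simpa using this

theorem degree_le_three_cases {v a b c : V} (h : G.degree v ≤ 3) (ha : G.Adj v a)
    (hb : G.Adj v b) (hc : G.Adj v c) (hab : a ≠ b) (hac : a ≠ c) (hbc : b ≠ c) {x : V}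
    (hx : G.Adj v x) : x = a ∨ x = b ∨ x = c := by
  have hs : ({a, b, c} : Finset V) = G.neighborFinset v := by
    apply Finset.eq_of_subset_of_card_le
    · intro y hy
      simp only [Finset.mem_insert, Finset.mem_singleton] at hy
      rw [mem_neighborFinset]
      grind
    · rw [card_neighborFinset_eq_degree, Finset.card_eq_three.2 ⟨a, b, c, hab, hac, hbc, rfl⟩]
      exact h
  have : x ∈ ({a, b, c} : Finset V) := by rw [hs]; simpa using hx
  simpa using this

theorem level_one_spec {w : V} (h : w ∈ level G A 1) :
    w ∉ A ∧ ∃ a ∈ A, G.Adj w a ∧ ∀ x ∈ A, G.Adj w x → x = a := by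
  simp only [level, Finset.mem_filter, Finset.mem_univ, true_and] at h
  obtain ⟨hw, hc⟩ := h
  obtain ⟨a, ha⟩ := Finset.card_eq_one.1 hc
  simp only [Finset.ext_iff, Finset.mem_inter, mem_neighborFinset, Finset.mem_singleton] at ha
  exact ⟨hw, a, ((ha a).2 rfl).2, ((ha a).2 rfl).1, fun x hx hwx => (ha x).1 ⟨hwx, hx⟩⟩

theorem level_two_spec {u : V} (h : u ∈ level G A 2) :
    u ∉ A ∧ ∃ p ∈ A, ∃ q ∈ A, p ≠ q ∧ G.Adj u p ∧ G.Adj u q ∧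
      ∀ x ∈ A, G.Adj u x → x = p ∨ x = q := by
  simp only [level, Finset.mem_filter, Finset.mem_univ, true_and] at h
  obtain ⟨hw, hc⟩ := h
  obtain ⟨p, q, hpq, ha⟩ := Finset.card_eq_two.1 hc
  simp only [Finset.ext_iff, Finset.mem_inter, mem_neighborFinset, Finset.mem_insert,
    Finset.mem_singleton] at ha
  exact ⟨hw, p, by grind, q, by grind, hpq, by grind, by grind, by grind⟩

theorem IsHalfMinimum.level_three_spec (hA : IsHalfMinimum G A) {v : V} (h : v ∈ level G A 3) :
    v ∉ A ∧ ∃ a ∈ A, ∃ b ∈ A, ∃ c ∈ A, a ≠ b ∧ a ≠ c ∧ b ≠ c ∧ G.Adj v a ∧ G.Adj v b ∧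
      G.Adj v c ∧ ∀ x, G.Adj v x → x = a ∨ x = b ∨ x = c := by
  simp only [level, Finset.mem_filter, Finset.mem_univ, true_and] at h
  obtain ⟨hw, hc⟩ := h
  obtain ⟨a, b, c, hab, hac, hbc, ha⟩ := Finset.card_eq_three.1 hc
  simp only [Finset.ext_iff, Finset.mem_inter, mem_neighborFinset, Finset.mem_insert,
    Finset.mem_singleton] at ha
  refine ⟨hw, a, by grind, b, by grind, c, by grind, hab, hac, hbc, by grind, by grind,
    by grind, fun x hx => ?_⟩
  exact degree_le_three_cases (hA.le_three v) ((ha a).2 (by simp)).1 ((ha b).2 (by simp)).1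
    ((ha c).2 (by simp)).1 hab hac hbc hx

theorem level_disjoint {j k : ℕ} {v : V} (hj : v ∈ level G A j) (hk : v ∈ level G A k) :
    j = k := by
  simp only [level, Finset.mem_filter, Finset.mem_univ, true_and] at hj hk
  exact hj.2.symm.trans hk.2

theorem IsHalfMinimum.level_cases (hA : IsHalfMinimum G A) {v : V} (hv : v ∉ A) :
    v ∈ level G A 1 ∨ v ∈ level G A 2 ∨ v ∈ level G A 3 := by
  simp only [level, Finset.mem_filter, Finset.mem_univ, true_and, hv, not_false_eq_true]
  have h1 : 0 < (G.neighborFinset v ∩ A).card := by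
    obtain ⟨u, hu, huv⟩ := hA.dom v hv
    exact Finset.card_pos.2 ⟨u, by simp [hu, huv.symm]⟩
  have h2 : (G.neighborFinset v ∩ A).card ≤ 3 :=
    (Finset.card_le_card Finset.inter_subset_left).trans (hA.le_three v)
  omega

/-- Replacing `R ⊆ A` by an independent set `T` that dominates everything only `R` dominated
cannot decrease the cardinality. -/
theorem IsHalfMinimum.card_le_of_exchange (hA : IsHalfMinimum G A) {R T : Finset V}
    (hR : R ⊆ A) (hT : ∀ s ∈ T, ∀ t ∈ T, ¬ G.Adj s t)
    (hTR : ∀ t ∈ T, ∀ a ∈ A, G.Adj t a → a ∈ R) (hRT : ∀ r ∈ R, ∃ t ∈ T, G.Adj t r)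
    (hU : ∀ u ∉ A, (∀ a ∈ A, G.Adj u a → a ∈ R) → u ∈ T ∨ ∃ t ∈ T, G.Adj t u) :
    R.card ≤ T.card := by
  have key := hA.min ((A \ R) ∪ T) ?_ ?_
  · have h1 := Finset.card_union_le (A \ R) T
    have h2 := Finset.card_sdiff_add_card_eq_card hR
    omega
  · intro v hv
    simp only [Finset.mem_union, Finset.mem_sdiff, not_or, not_and, not_not] at hv
    by_cases hvA : v ∈ A
    · obtain ⟨t, ht, h⟩ := hRT v (hv.1 hvA)
      exact ⟨t, by simp [ht], h⟩
    · by_cases h : ∀ a ∈ A, G.Adj v a → a ∈ R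
      · obtain h | ⟨t, ht, h⟩ := hU v hvA h
        · exact absurd h hv.2
        · exact ⟨t, by simp [ht], h⟩
      · push Not at h
        obtain ⟨a, ha, hva, haR⟩ := h
        exact ⟨a, by simp [ha, haR], hva.symm⟩
  · intro u hu v hv huv
    simp only [Finset.mem_union, Finset.mem_sdiff] at hu hv
    rcases hu with hu | hu <;> rcases hv with hv | hv
    · exact hA.ind u hu.1 v hv.1 huv
    · exact hu.2 (hTR v hv u hu.1 huv.symm)
    · exact hv.2 (hTR u hu v hv.1 huv)
    · exact hT u hu v hv huv

theorem IsHalfMinimum.exists_of_two (hA : IsHalfMinimum G A) {u p q : V}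
    (hp : p ∈ A) (hq : q ∈ A) (hpq : p ≠ q) (hup : G.Adj u p) (huq : G.Adj u q)
    (h : ∀ x ∈ A, G.Adj u x → x = p ∨ x = q) :
    ∃ u' ∉ A, u' ≠ u ∧ ¬ G.Adj u u' ∧ ∀ x ∈ A, G.Adj u' x → x = p ∨ x = q := by
  by_contra! hc
  have := hA.card_le_of_exchange (R := {p, q}) (T := {u}) (by grind)
    (by simp) (by simpa using h) (by simp [hup, huq]) ?_
  · rw [Finset.card_pair hpq] at this
    simp at this
  · intro x hx hxA
    simp only [Finset.mem_insert, Finset.mem_singleton] at hxA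
    simp only [Finset.mem_singleton, exists_eq_left]
    grind

theorem IsHalfMinimum.exists_of_three (hA : IsHalfMinimum G A) {v a b c : V}
    (ha : a ∈ A) (hb : b ∈ A) (hc : c ∈ A) (hab : a ≠ b) (hac : a ≠ c) (hbc : b ≠ c)
    (hva : G.Adj v a) (hvb : G.Adj v b) (hvc : G.Adj v c) :
    ∃ w ∉ A, w ≠ v ∧ ∀ x ∈ A, G.Adj w x → x = a ∨ x = b ∨ x = c := by
  have hN := @degree_le_three_cases _ _ _ _ _ v a b c (hA.le_three v) hva hvb hvc hab hac hbc
  by_contra! hcon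
  have := hA.card_le_of_exchange (R := {a, b, c}) (T := {v}) (by grind) (by simp)
    (by simpa using fun x _ => @hN x) (by simp [hva, hvb, hvc]) ?_
  · rw [Finset.card_eq_three.2 ⟨a, b, c, hab, hac, hbc, rfl⟩] at this
    simp at this
  · intro x hx hxA
    simp only [Finset.mem_insert, Finset.mem_singleton] at hxA
    simp only [Finset.mem_singleton, exists_eq_left]
    grind

theorem IsHalfMinimum.exists_second_of_three (hA : IsHalfMinimum G A) {v a b c w : V}
    (ha : a ∈ A) (hb : b ∈ A) (hc : c ∈ A) (hab : a ≠ b) (hac : a ≠ c)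
    (hbc : b ≠ c) (hva : G.Adj v a) (hvb : G.Adj v b) (hvc : G.Adj v c)
    (hwA : w ∉ A) (hwN : ∀ x ∈ A, G.Adj w x → x = a ∨ x = b ∨ x = c) :
    ∃ w' ∉ A, w' ≠ v ∧ w' ≠ w ∧ ∀ x ∈ A, G.Adj w' x → x = a ∨ x = b ∨ x = c := by
  have hN := @degree_le_three_cases _ _ _ _ _ v a b c (hA.le_three v) hva hvb hvc hab hac hbc
  by_contra! hcon
  have := hA.card_le_of_exchange (R := {a, b, c}) (T := {v, w}) (by grind)
    ?_ ?_ (by simp [hva, hvb, hvc]) ?_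
  · rw [Finset.card_eq_three.2 ⟨a, b, c, hab, hac, hbc, rfl⟩] at this
    have := Finset.card_le_two (a := v) (b := w)
    omega
  · have := @G.adj_comm
    have := @G.irrefl
    simp only [Finset.mem_insert, Finset.mem_singleton]
    grind
  · simp only [Finset.mem_insert, Finset.mem_singleton]
    grind
  · intro x hx hxA
    simp only [Finset.mem_insert, Finset.mem_singleton] at hxA ⊢
    grind

theorem IsHalfMinimum.iso_of_hasK33 (hA : IsHalfMinimum G A) (hconn : G.Connected)
    (h : HasK33 G A) : Nonempty (G ≃g completeBipartiteGraph (Fin 3) (Fin 3)) := by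
  obtain ⟨x, y, z, a, b, c, hx, hy, hz, ha, hb, hc, hxy, hxz, hyz, hab, hac, hbc,
    xa, xb, xc, ya, yb, yc, za, zb, zc⟩ := h
  have Nx := @degree_le_three_cases _ _ _ _ _ x a b c (hA.le_three x) xa xb xc hab hac hbc
  have Ny := @degree_le_three_cases _ _ _ _ _ y a b c (hA.le_three y) ya yb yc hab hac hbc
  have Nz := @degree_le_three_cases _ _ _ _ _ z a b c (hA.le_three z) za zb zc hab hac hbc
  have Na := @degree_le_three_cases _ _ _ _ _ a x y z (hA.le_three a) xa.symm ya.symm za.symm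
    hxy hxz hyz
  have Nb := @degree_le_three_cases _ _ _ _ _ b x y z (hA.le_three b) xb.symm yb.symm zb.symm
    hxy hxz hyz
  have Nc := @degree_le_three_cases _ _ _ _ _ c x y z (hA.le_three c) xc.symm yc.symm zc.symm
    hxy hxz hyz
  have hall : ∀ t, t = x ∨ t = y ∨ t = z ∨ t = a ∨ t = b ∨ t = c := by
    intro t
    induction hconn.preconnected x t with
    | intro p =>
      have : ∀ (s t : V) (p : G.Walk s t), (s = x ∨ s = y ∨ s = z ∨ s = a ∨ s = b ∨ s = c) →
          (t = x ∨ t = y ∨ t = z ∨ t = a ∨ t = b ∨ t = c) := by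
        intro s t p
        induction p with
        | nil => exact id
        | cons hadj _ ih => intro hs; apply ih; grind
      exact this x t p (Or.inl rfl)
  let f : Fin 3 ⊕ Fin 3 → V := Sum.elim ![x, y, z] ![a, b, c]
  have hf : Function.Bijective f := by
    constructor
    · rintro (i | i) (j | j) hij <;> fin_cases i <;> fin_cases j <;> simp [f] at hij ⊢ <;> grind
    · intro t
      rcases hall t with rfl | rfl | rfl | rfl | rfl | rfl
      exacts [⟨.inl 0, rfl⟩, ⟨.inl 1, rfl⟩, ⟨.inl 2, rfl⟩, ⟨.inr 0, rfl⟩, ⟨.inr 1, rfl⟩,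
        ⟨.inr 2, rfl⟩]
  have hadj : ∀ s t, G.Adj (f s) (f t) ↔ (completeBipartiteGraph (Fin 3) (Fin 3)).Adj s t := by
    have hcomm := @G.adj_comm
    rintro (i | i) (j | j) <;> fin_cases i <;> fin_cases j <;> simp [f] <;> grind
  exact ⟨(RelIso.mk (Equiv.ofBijective f hf) (fun {s t} => hadj s t) :
    completeBipartiteGraph (Fin 3) (Fin 3) ≃g G).symm⟩

theorem sum_sum_neighbor (S : Finset V) (g : V → ℕ) :
    ∑ v ∈ S, ∑ a ∈ G.neighborFinset v ∩ A, g a =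
      ∑ a ∈ A, g a * (G.neighborFinset a ∩ S).card := by
  rw [Finset.sum_comm' (t' := A) (s' := fun a => G.neighborFinset a ∩ S)]
  · simp [mul_comm]
  · intro x y
    simp only [Finset.mem_inter, mem_neighborFinset, G.adj_comm x y]
    tauto

theorem IsHalfMinimum.neighborFinset_inter_compl (hA : IsHalfMinimum G A) {a : V}
    (ha : a ∈ A) : G.neighborFinset a ∩ Aᶜ = G.neighborFinset a := by
  rw [Finset.inter_eq_left]
  intro x hx
  rw [mem_neighborFinset] at hx
  rw [Finset.mem_compl]
  exact fun h => hA.ind a ha x h hx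

theorem IsHalfMinimum.card_level_three (hA : IsHalfMinimum G A) :
    (level G A 3).card = ∑ a ∈ A, ((G.neighborFinset a ∩ level G A 1).card +
      if G.degree a = 3 then 1 else 0) := by
  have h1 : (level G A 1).card = ∑ a ∈ A, (G.neighborFinset a ∩ level G A 1).card := by
    have := sum_sum_neighbor (G := G) (A := A) (level G A 1) (fun _ => 1)
    simp only [Finset.sum_const, smul_eq_mul, mul_one, one_mul] at this
    rw [← this, Finset.card_eq_sum_ones]
    refine Finset.sum_congr rfl fun v hv => ?_
    simp only [level, Finset.mem_filter] at hv
    exact hv.2.2.symm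
  have h2 : ∑ v ∈ Aᶜ, (G.neighborFinset v ∩ A).card = ∑ a ∈ A, G.degree a := by
    have := sum_sum_neighbor (G := G) (A := A) Aᶜ (fun _ => 1)
    simp only [Finset.sum_const, smul_eq_mul, mul_one, one_mul] at this
    rw [this]
    refine Finset.sum_congr rfl fun a ha => ?_
    rw [hA.neighborFinset_inter_compl ha, card_neighborFinset_eq_degree]
  have h3 : ∑ a ∈ A, G.degree a = A.card * 2 + ∑ a ∈ A, if G.degree a = 3 then 1 else 0 := by
    rw [← smul_eq_mul, ← Finset.sum_const, ← Finset.sum_add_distrib]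
    refine Finset.sum_congr rfl fun a _ => ?_
    have := hA.two_le a
    have := hA.le_three a
    split_ifs <;> omega
  have hlev : ∀ k, (level G A k).card =
      ∑ v ∈ Aᶜ, if (G.neighborFinset v ∩ A).card = k then 1 else 0 := by
    intro k
    rw [← Finset.card_filter]
    congr 1
    ext v
    simp [level]
  have h4 : ∑ v ∈ Aᶜ, (G.neighborFinset v ∩ A).card + (level G A 1).card =
      Aᶜ.card * 2 + (level G A 3).card := by
    rw [hlev, hlev, ← smul_eq_mul, ← Finset.sum_const, ← Finset.sum_add_distrib,
      ← Finset.sum_add_distrib]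
    refine Finset.sum_congr rfl fun v hv => ?_
    rw [Finset.mem_compl] at hv
    have := hA.level_cases hv
    simp only [level, Finset.mem_filter, Finset.mem_univ, true_and, hv, not_false_eq_true] at this
    split_ifs <;> omega
  have h5 := Finset.card_add_card_compl A
  have h6 := hA.card
  rw [Finset.sum_add_distrib]
  omega

theorem card_inter_level_add_card_inter_level_le (G : SimpleGraph V) [DecidableRel G.Adj]
    (A : Finset V) (a : V) : (G.neighborFinset a ∩ level G A 1).card +
      (G.neighborFinset a ∩ level G A 3).card ≤ G.degree a := by
  rw [← Finset.card_union_of_disjoint]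
  · rw [← card_neighborFinset_eq_degree]
    exact Finset.card_le_card (by grind)
  · rw [Finset.disjoint_left]
    intro x hx hx'
    rw [Finset.mem_inter] at hx hx'
    exact absurd (level_disjoint hx.2 hx'.2) (by decide)

theorem IsHalfMinimum.charge_mul_le (hA : IsHalfMinimum G A) (a : V) :
    charge G A a * (G.neighborFinset a ∩ level G A 3).card ≤
      (G.neighborFinset a ∩ level G A 1).card + if G.degree a = 3 then 1 else 0 := by
  have h := card_inter_level_add_card_inter_level_le G A a
  have := hA.two_le a
  have := hA.le_three a
  unfold charge
  split_ifs <;> omega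

theorem charge_eq_one_of_level_one {a w : V} (hw : w ∈ level G A 1) (haw : G.Adj a w) :
    charge G A a = 1 := by
  unfold charge
  rw [if_pos]
  exact Or.inl (Finset.card_pos.2 ⟨w, by simp [hw, haw]⟩)

theorem charge_eq_one_of_level_two {a v w w' : V} (hv : v ∈ level G A 3) (hav : G.Adj a v)
    (hw : w ∈ level G A 2) (hw' : w' ∈ level G A 2) (h3 : G.degree a = 3)
    (hN : ∀ x, G.Adj a x → x = v ∨ x = w ∨ x = w') : charge G A a = 1 := by
  unfold charge
  rw [if_pos]
  refine Or.inr ⟨h3, Finset.card_eq_one.2 ⟨v, ?_⟩⟩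
  ext x
  simp only [Finset.mem_inter, mem_neighborFinset, Finset.mem_singleton]
  constructor
  · rintro ⟨hx, hx3⟩
    rcases hN x hx with rfl | rfl | rfl
    · rfl
    · exact absurd (level_disjoint hx3 hw) (by decide)
    · exact absurd (level_disjoint hx3 hw') (by decide)
  · rintro rfl
    exact ⟨hav, hv⟩

theorem three_le_degree {v a b c : V} (ha : G.Adj v a)
    (hb : G.Adj v b) (hc : G.Adj v c) (hab : a ≠ b) (hac : a ≠ c) (hbc : b ≠ c) :
    3 ≤ G.degree v := by
  rw [← card_neighborFinset_eq_degree, ← Finset.card_eq_three.2 ⟨a, b, c, hab, hac, hbc, rfl⟩]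
  refine Finset.card_le_card fun x hx => ?_
  simp only [Finset.mem_insert, Finset.mem_singleton] at hx
  rw [mem_neighborFinset]
  grind

theorem IsHalfMinimum.level_one_or_two_charges (hA : IsHalfMinimum G A) (hK : ¬ HasK33 G A)
    {v : V} (hv : v ∈ level G A 3) :
    (∃ a ∈ A, G.Adj v a ∧ ∃ w ∈ level G A 1, G.Adj a w) ∨
      ∃ p ∈ A, ∃ q ∈ A, p ≠ q ∧ G.Adj v p ∧ G.Adj v q ∧
        charge G A p = 1 ∧ charge G A q = 1 := by
  by_cases h1 : ∃ a ∈ A, G.Adj v a ∧ ∃ w ∈ level G A 1, G.Adj a w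
  · exact Or.inl h1
  right
  obtain ⟨hvA, a, ha, b, hb, c, hc, hab, hac, hbc, va, vb, vc, hN⟩ := hA.level_three_spec hv
  have no_one : ∀ w ∉ A, (∀ x ∈ A, G.Adj w x → x = a ∨ x = b ∨ x = c) → w ∉ level G A 1 := by
    intro w _ hwN hw1
    obtain ⟨-, x, hx, hwx, -⟩ := level_one_spec hw1
    refine h1 ⟨x, hx, ?_, w, hw1, hwx.symm⟩
    rcases hwN x hx hwx with rfl | rfl | rfl <;> assumption
  have main : ∀ w ∉ A, (∀ x ∈ A, G.Adj w x → x = a ∨ x = b ∨ x = c) → w ∈ level G A 2 →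
      ∃ p ∈ A, ∃ q ∈ A, p ≠ q ∧ G.Adj v p ∧ G.Adj v q ∧
        charge G A p = 1 ∧ charge G A q = 1 := by
    intro w hwA hwN hw2
    obtain ⟨-, p, hp, q, hq, hpq, wp, wq, hwpq⟩ := level_two_spec hw2
    have vp : G.Adj v p := by rcases hwN p hp wp with rfl | rfl | rfl <;> assumption
    have vq : G.Adj v q := by rcases hwN q hq wq with rfl | rfl | rfl <;> assumption
    obtain ⟨w', hw'A, hw'w, -, hw'pq⟩ := hA.exists_of_two hp hq hpq wp wq hwpq
    have hw'2 : w' ∈ level G A 2 := by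
      rcases hA.level_cases hw'A with h | h | h
      · exact absurd h (no_one w' hw'A (by grind))
      · exact h
      · obtain ⟨-, a', ha', b', hb', c', hc', hab', hac', hbc', va', vb', vc', -⟩ :=
          hA.level_three_spec h
        grind
    have hw'v : w' ≠ v := by
      rintro rfl
      exact absurd (level_disjoint hw'2 hv) (by decide)
    have hwv : w ≠ v := by
      rintro rfl
      exact absurd (level_disjoint hw2 hv) (by decide)
    have w'pq : G.Adj w' p ∧ G.Adj w' q := by
      obtain ⟨-, p', hp', q', hq', hpq', wp', wq', -⟩ := level_two_spec hw'2
      have := hw'pq p' hp' wp'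
      have := hw'pq q' hq' wq'
      grind
    have hfin : ∀ r, G.Adj v r → G.Adj w r → G.Adj w' r → charge G A r = 1 := by
      intro r vr wr w'r
      refine charge_eq_one_of_level_two hv vr.symm hw2 hw'2
        (le_antisymm (hA.le_three r)
          (three_le_degree vr.symm wr.symm w'r.symm hwv.symm hw'v.symm hw'w.symm))
        fun x hx => degree_le_three_cases (hA.le_three r) vr.symm wr.symm w'r.symm
          hwv.symm hw'v.symm hw'w.symm hx
    exact ⟨p, hp, q, hq, hpq, vp, vq, hfin p vp wp w'pq.1, hfin q vq wq w'pq.2⟩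
  have full : ∀ w ∉ A, (∀ x ∈ A, G.Adj w x → x = a ∨ x = b ∨ x = c) → w ∈ level G A 3 →
      G.Adj w a ∧ G.Adj w b ∧ G.Adj w c := by
    intro w hw hwN hw3
    obtain ⟨-, a', ha', b', hb', c', hc', hab', hac', hbc', va', vb', vc', -⟩ :=
      hA.level_three_spec hw3
    grind
  obtain ⟨w, hwA, hwv, hwN⟩ := hA.exists_of_three ha hb hc hab hac hbc va vb vc
  obtain ⟨w', hw'A, hw'v, hw'w, hw'N⟩ :=
    hA.exists_second_of_three ha hb hc hab hac hbc va vb vc hwA hwN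
  rcases hA.level_cases hwA with h | h | h
  · exact absurd h (no_one w hwA hwN)
  · exact main w hwA hwN h
  rcases hA.level_cases hw'A with h' | h' | h'
  · exact absurd h' (no_one w' hw'A hw'N)
  · exact main w' hw'A hw'N h'
  obtain ⟨wa, wb, wc⟩ := full w hwA hwN h
  obtain ⟨wa', wb', wc'⟩ := full w' hw'A hw'N h'
  exact absurd ⟨v, w, w', a, b, c, hvA, hwA, hw'A, ha, hb, hc, hwv.symm, hw'v.symm, hw'w.symm,
    hab, hac, hbc, va, vb, vc, wa, wb, wc, wa', wb', wc'⟩ hK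

theorem IsHalfMinimum.one_le_sum_charge (hA : IsHalfMinimum G A) (hK : ¬ HasK33 G A)
    {v : V} (hv : v ∈ level G A 3) : 1 ≤ ∑ a ∈ G.neighborFinset v ∩ A, charge G A a := by
  obtain ⟨a, ha, hva, h⟩ : ∃ a ∈ A, G.Adj v a ∧ charge G A a = 1 := by
    obtain ⟨a, ha, hva, w, hw, haw⟩ | ⟨p, hp, q, hq, hpq, vp, vq, h, h'⟩ :=
      hA.level_one_or_two_charges hK hv
    · exact ⟨a, ha, hva, charge_eq_one_of_level_one hw haw⟩
    · exact ⟨p, hp, vp, h⟩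
  rw [← h]
  exact Finset.single_le_sum (f := charge G A) (fun _ _ => Nat.zero_le _) (by simp [ha, hva])

theorem IsHalfMinimum.charge_balance (hA : IsHalfMinimum G A) (hK : ¬ HasK33 G A) :
    (∀ v ∈ level G A 3, ∑ a ∈ G.neighborFinset v ∩ A, charge G A a = 1) ∧
      ∀ a ∈ A, charge G A a * (G.neighborFinset a ∩ level G A 3).card =
        (G.neighborFinset a ∩ level G A 1).card + if G.degree a = 3 then 1 else 0 := by
  have h1 := hA.card_level_three
  have h2 := sum_sum_neighbor (G := G) (A := A) (level G A 3) (charge G A)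
  have h3 : ∑ v ∈ level G A 3, 1 ≤ ∑ v ∈ level G A 3,
      ∑ a ∈ G.neighborFinset v ∩ A, charge G A a :=
    Finset.sum_le_sum fun v hv => hA.one_le_sum_charge hK hv
  have h4 := Finset.sum_le_sum fun a (_ : a ∈ A) => hA.charge_mul_le a
  rw [← Finset.card_eq_sum_ones] at h3
  constructor
  · have := (Finset.sum_eq_sum_iff_of_le fun v hv => hA.one_le_sum_charge hK hv).1
      (by rw [← Finset.card_eq_sum_ones]; omega)
    exact fun v hv => (this v hv).symm
  · exact (Finset.sum_eq_sum_iff_of_le fun a (_ : a ∈ A) => hA.charge_mul_le a).1 (by omega)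

theorem IsHalfMinimum.neighbors_of_adj_level_one (hA : IsHalfMinimum G A) (hK : ¬ HasK33 G A)
    {a w : V} (ha : a ∈ A) (hw : w ∈ level G A 1) (haw : G.Adj a w) :
    (∃ v ∈ level G A 3, G.Adj a v) ∧ ∀ x, G.Adj a x → x = w ∨ x ∈ level G A 3 := by
  have hbal := (hA.charge_balance hK).2 a ha
  rw [charge_eq_one_of_level_one hw haw, one_mul] at hbal
  have hle := card_inter_level_add_card_inter_level_le G A a
  have h2 := hA.two_le a
  have h3 := hA.le_three a
  have hwmem : w ∈ G.neighborFinset a ∩ level G A 1 := by simp [hw, haw]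
  have hpos : 0 < (G.neighborFinset a ∩ level G A 1).card := Finset.card_pos.2 ⟨w, hwmem⟩
  have hk : (G.neighborFinset a ∩ level G A 1).card = 1 := by
    split_ifs at hbal <;> omega
  have hsum : G.degree a ≤ (G.neighborFinset a ∩ level G A 1).card +
      (G.neighborFinset a ∩ level G A 3).card := by
    split_ifs at hbal <;> omega
  constructor
  · have : 0 < (G.neighborFinset a ∩ level G A 3).card := by omega
    obtain ⟨v, hv⟩ := Finset.card_pos.1 this
    simp only [Finset.mem_inter, mem_neighborFinset] at hv
    exact ⟨v, hv.2, hv.1⟩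
  · intro x hx
    have hsub : (G.neighborFinset a ∩ level G A 1) ∪ (G.neighborFinset a ∩ level G A 3) =
        G.neighborFinset a := by
      refine Finset.eq_of_subset_of_card_le (by grind) ?_
      rw [Finset.card_union_of_disjoint]
      · rwa [card_neighborFinset_eq_degree]
      · rw [Finset.disjoint_left]
        intro y hy hy'
        rw [Finset.mem_inter] at hy hy'
        exact absurd (level_disjoint hy.2 hy'.2) (by decide)
    have hx' : x ∈ G.neighborFinset a := by simpa using hx
    rw [← hsub, Finset.mem_union] at hx'
    rcases hx' with h | h
    · obtain ⟨y, hy⟩ := Finset.card_eq_one.1 hk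
      rw [hy, Finset.mem_singleton] at h hwmem
      exact Or.inl (h.trans hwmem.symm)
    · exact Or.inr (Finset.mem_inter.1 h).2

theorem IsHalfMinimum.exists_adj_level_three (hA : IsHalfMinimum G A) (hK : ¬ HasK33 G A)
    {a : V} (ha : a ∈ A) (h3 : G.degree a = 3) : ∃ v ∈ level G A 3, G.Adj a v := by
  have hbal := (hA.charge_balance hK).2 a ha
  rw [if_pos h3] at hbal
  have : 0 < (G.neighborFinset a ∩ level G A 3).card := by
    rw [Nat.pos_iff_ne_zero]
    intro h0
    rw [h0] at hbal
    omega
  obtain ⟨v, hv⟩ := Finset.card_pos.1 this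
  simp only [Finset.mem_inter, mem_neighborFinset] at hv
  exact ⟨v, hv.2, hv.1⟩

theorem charge_add_charge_le {v p q : V} (hp : p ∈ A) (hq : q ∈ A) (hpq : p ≠ q)
    (vp : G.Adj v p) (vq : G.Adj v q) :
    charge G A p + charge G A q ≤ ∑ a ∈ G.neighborFinset v ∩ A, charge G A a := by
  rw [← Finset.sum_pair hpq]
  refine Finset.sum_le_sum_of_subset fun x hx => ?_
  simp only [Finset.mem_insert, Finset.mem_singleton] at hx
  rw [Finset.mem_inter, mem_neighborFinset]
  grind

theorem IsHalfMinimum.degree_eq_two_of_charge (hA : IsHalfMinimum G A) (hK : ¬ HasK33 G A)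
    {b : V} (hb : b ∈ A) (h : charge G A b = 0) :
    G.degree b = 2 ∧ ∀ w ∈ level G A 1, ¬ G.Adj b w := by
  constructor
  · have hbal := (hA.charge_balance hK).2 b hb
    have := hA.two_le b
    have := hA.le_three b
    rw [h, zero_mul] at hbal
    split_ifs at hbal
    omega
  · intro w hw hbw
    rw [charge_eq_one_of_level_one hw hbw] at h
    omega

theorem IsHalfMinimum.exists_isPendantBlock (hA : IsHalfMinimum G A) (hK : ¬ HasK33 G A)
    {v : V} (hv : v ∈ level G A 3) : ∃ v' w a b c, w ∈ level G A 1 ∧ v' ∈ level G A 3 ∧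
      IsPendantBlock G A v v' w a b c := by
  have hsum := (hA.charge_balance hK).1 v hv
  obtain ⟨a, ha, va, w, hw, aw⟩ : ∃ a ∈ A, G.Adj v a ∧ ∃ w ∈ level G A 1, G.Adj a w := by
    obtain h | ⟨p, hp, q, hq, hpq, vp, vq, h, h'⟩ := hA.level_one_or_two_charges hK hv
    · exact h
    · have := charge_add_charge_le hp hq hpq vp vq
      omega
  have hca := charge_eq_one_of_level_one hw aw
  obtain ⟨b, hb, c, hc, hab, hac, hbc, vb, vc, hN⟩ : ∃ b ∈ A, ∃ c ∈ A, a ≠ b ∧ a ≠ c ∧ b ≠ c ∧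
      G.Adj v b ∧ G.Adj v c ∧ ∀ x, G.Adj v x → x = a ∨ x = b ∨ x = c := by
    obtain ⟨-, a', ha', b', hb', c', hc', hab', hac', hbc', va', vb', vc', hN⟩ :=
      hA.level_three_spec hv
    rcases hN a va with rfl | rfl | rfl
    · exact ⟨b', hb', c', hc', hab', hac', hbc', vb', vc', hN⟩
    · exact ⟨a', ha', c', hc', hab'.symm, hbc', hac', va', vc', by grind⟩
    · exact ⟨a', ha', b', hb', hac'.symm, hbc'.symm, hab', va', vb', by grind⟩
  have hcb : charge G A b = 0 := by
    have := charge_add_charge_le ha hb hab va vb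
    omega
  have hcc : charge G A c = 0 := by
    have := charge_add_charge_le ha hc hac va vc
    omega
  obtain ⟨hdb, hb1⟩ := hA.degree_eq_two_of_charge hK hb hcb
  obtain ⟨hdc, hc1⟩ := hA.degree_eq_two_of_charge hK hc hcc
  have hNa := (hA.neighbors_of_adj_level_one hK ha hw aw).2
  have hvA := (hA.level_three_spec hv).1
  obtain ⟨hwA, a₀, ha₀, -, hwN⟩ := level_one_spec hw
  obtain rfl := hwN a ha aw.symm
  have hwv : w ≠ v := by
    rintro rfl
    exact absurd (level_disjoint hw hv) (by decide)
  obtain ⟨v', hv'A, hv'v, hv'w, hv'N⟩ := hA.exists_second_of_three (w := w) ha hb hc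
    hab hac hbc va vb vc hwA (by grind)
  have hv' : v' ∈ level G A 3 := by
    rcases hA.level_cases hv'A with h | h | h
    · obtain ⟨-, x, hx, v'x, -⟩ := level_one_spec h
      rcases hv'N x hx v'x with rfl | rfl | rfl
      · rcases hNa v' v'x.symm with h' | h'
        · exact absurd h' hv'w
        · exact h'
      · exact absurd v'x.symm (hb1 v' h)
      · exact absurd v'x.symm (hc1 v' h)
    · by_cases v'a : G.Adj v' a
      · rcases hNa v' v'a.symm with h' | h'
        · exact absurd h' hv'w
        · exact h'
      · obtain ⟨-, p, hp, q, hq, hpq, v'p, v'q, hv'pq⟩ := level_two_spec h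
        have v'b : G.Adj v' b := by
          have := hv'N p hp v'p
          have := hv'N q hq v'q
          grind
        have v'c : G.Adj v' c := by
          have := hv'N p hp v'p
          have := hv'N q hq v'q
          grind
        obtain ⟨u, huA, huv', -, huN⟩ := hA.exists_of_two hb hc hbc v'b v'c (by grind)
        obtain ⟨y, hy, yu⟩ := hA.dom u huA
        have huv : u = v := by
          rcases huN y hy yu.symm with rfl | rfl
          · have := degree_two_cases hdb vb.symm v'b.symm hv'v.symm yu
            grind
          · have := degree_two_cases hdc vc.symm v'c.symm hv'v.symm yu
            grind
        subst huv
        have := huN a ha va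
        grind
    · exact h
  obtain ⟨v'a, v'b, v'c⟩ : G.Adj v' a ∧ G.Adj v' b ∧ G.Adj v' c := by
    obtain ⟨-, a', ha', b', hb', c', hc', hab', hac', hbc', va', vb', vc', -⟩ :=
      hA.level_three_spec hv'
    grind
  refine ⟨v', w, a, b, c, hw, hv', ?_⟩
  exact
    { v_notMem := hvA
      v_notMem' := hv'A
      w_notMem := hwA
      a_mem := ha
      b_mem := hb
      c_mem := hc
      v_ne := hv'v.symm
      w_ne := hwv
      w_ne' := hv'w.symm
      ab_ne := hab
      ac_ne := hac
      bc_ne := hbc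
      adj_va := va
      adj_vb := vb
      adj_vc := vc
      adj_va' := v'a
      adj_vb' := v'b
      adj_vc' := v'c
      adj_wa := aw.symm
      nbr_v := hN
      nbr_v' := fun x hx => degree_le_three_cases (hA.le_three v') v'a v'b v'c hab hac hbc hx
      nbr_w := hwN
      nbr_a := fun x hx => degree_le_three_cases (hA.le_three a) va.symm v'a.symm aw
        hv'v.symm hwv.symm hv'w hx
      nbr_b := fun x hx => degree_two_cases hdb vb.symm v'b.symm hv'v.symm hx
      nbr_c := fun x hx => degree_two_cases hdc vc.symm v'c.symm hv'v.symm hx }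

theorem IsHalfMinimum.exists_isPendantBlock_of_level_one (hA : IsHalfMinimum G A)
    (hK : ¬ HasK33 G A) {w : V} (hw : w ∈ level G A 1) :
    ∃ v v' a b c, IsPendantBlock G A v v' w a b c := by
  obtain ⟨-, a, ha, wa, -⟩ := level_one_spec hw
  obtain ⟨⟨v, hv, av⟩, hN⟩ := hA.neighbors_of_adj_level_one hK ha hw wa.symm
  obtain ⟨v', w', a', b, c, hw', hv', h⟩ := hA.exists_isPendantBlock hK hv
  have hne : ∀ x ∈ level G A 3, w ≠ x := by
    rintro x hx rfl
    exact absurd (level_disjoint hw hx) (by decide)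
  have := hne v hv
  have := hne v' hv'
  obtain rfl : a = a' := by
    rcases h.nbr_v a av.symm with rfl | rfl | rfl
    · rfl
    · have := h.nbr_b w wa.symm
      grind
    · have := h.nbr_c w wa.symm
      grind
  obtain rfl : w = w' := by
    have := h.nbr_a w wa.symm
    grind
  exact ⟨v, v', a, b, c, h⟩

theorem IsHalfMinimum.exists_isSquareBlock (hA : IsHalfMinimum G A) (hK : ¬ HasK33 G A)
    {u : V} (hu : u ∈ level G A 2) : ∃ u' p q, IsSquareBlock G A u u' p q := by
  obtain ⟨huA, p, hp, q, hq, hpq, up, uq, huN⟩ := level_two_spec hu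
  obtain ⟨u', hu'A, hu'u, huu', hu'N⟩ := hA.exists_of_two hp hq hpq up uq huN
  have no_one : ∀ r ∈ A, G.Adj u r → ∀ w ∈ level G A 1, ¬ G.Adj w r := by
    intro r hr ur w hw wr
    rcases (hA.neighbors_of_adj_level_one hK hr hw wr.symm).2 u ur.symm with rfl | h
    · exact absurd (level_disjoint hw hu) (by decide)
    · exact absurd (level_disjoint hu h) (by decide)
  have u'pq : G.Adj u' p ∧ G.Adj u' q := by
    rcases hA.level_cases hu'A with h | h | h
    · obtain ⟨-, x, hx, u'x, -⟩ := level_one_spec h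
      rcases hu'N x hx u'x with rfl | rfl
      · exact absurd u'x (no_one x hx up u' h)
      · exact absurd u'x (no_one x hx uq u' h)
    · obtain ⟨-, p', hp', q', hq', hpq', wp', wq', -⟩ := level_two_spec h
      have := hu'N p' hp' wp'
      have := hu'N q' hq' wq'
      grind
    · obtain ⟨-, a', ha', b', hb', c', hc', hab', hac', hbc', va', vb', vc', -⟩ :=
        hA.level_three_spec h
      grind
  have deg : ∀ r ∈ A, G.Adj u r → G.degree r = 2 := by
    intro r hr ur
    by_contra h
    have h3 : G.degree r = 3 := by
      have := hA.two_le r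
      have := hA.le_three r
      omega
    obtain ⟨v, hv, rv⟩ := hA.exists_adj_level_three hK hr h3
    obtain ⟨v', w, a, b, c, hw, hv', hP⟩ := hA.exists_isPendantBlock hK hv
    have hne : ∀ x ∈ level G A 3, u ≠ x := by
      rintro x hx rfl
      exact absurd (level_disjoint hu hx) (by decide)
    have := hne v hv
    have := hne v' hv'
    rcases hP.nbr_v r rv.symm with rfl | rfl | rfl
    · exact no_one r hr ur w hw hP.adj_wa
    · have := hP.nbr_b u ur.symm
      grind
    · have := hP.nbr_c u ur.symm
      grind
  exact ⟨u', p, q,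
    { left_notMem := huA
      right_notMem := hu'A
      left_mem := hp
      right_mem := hq
      ne := hu'u.symm
      ne' := hpq
      not_adj := huu'
      adj_up := up
      adj_uq := uq
      adj_up' := u'pq.1
      adj_uq' := u'pq.2
      nbr_u := huN
      nbr_u' := hu'N
      nbr_p := fun x hx =>
        degree_two_cases (deg p hp up) up.symm u'pq.1.symm hu'u.symm hx
      nbr_q := fun x hx =>
        degree_two_cases (deg q hq uq) uq.symm u'pq.2.symm hu'u.symm hx }⟩

theorem IsHalfMinimum.not_adj_of_isPendantBlock_of_isSquareBlock (hA : IsHalfMinimum G A)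
    {v v' w a b c z z' p q : V} (hP : IsPendantBlock G A v v' w a b c)
    (hS : IsSquareBlock G A z z' p q) : ¬ G.Adj w z := by
  intro hwz
  obtain ⟨h1, h2, h3, h4, h5, h6, h7, h8, h9, h10, h11, h12, h13, h14, h15, h16, h17, h18, h19,
    h20, h21, h22, h23, h24, h25⟩ := hP
  obtain ⟨k1, k2, k3, k4, k5, k6, k7, k8, k9, k10, k11, k12, k13, k14, k15⟩ := hS
  have hvz : v ≠ z := by grind
  have hcomm := @G.adj_comm
  have hirr := @G.irrefl
  have hv : ∀ s ∉ A, ¬ G.Adj v s ∧ ¬ G.Adj s v := by grind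
  have hv' : ∀ s ∉ A, ¬ G.Adj v' s ∧ ¬ G.Adj s v' := by grind
  have hzz : ¬ G.Adj z' z := by grind
  have := hA.card_le_of_exchange (R := {a, b, c, p, q}) (T := {v, v', z, z'})
    ?_ ?_ ?_ ?_ ?_
  · have hcard : ({a, b, c, p, q} : Finset V).card = 5 := by
      rw [Finset.card_insert_of_notMem, Finset.card_insert_of_notMem,
        Finset.card_insert_of_notMem, Finset.card_pair] <;> grind
    have := Finset.card_le_four (a := v) (b := v') (c := z) (d := z')
    omega
  all_goals
    simp only [Finset.mem_insert, Finset.mem_singleton, Finset.insert_subset_iff,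
      Finset.singleton_subset_iff, forall_eq_or_imp, forall_eq, exists_eq_or_imp, exists_eq_left]
  · grind
  · simp [hv, hv', h2, k1, k2, k7, hzz]
  · grind
  · grind
  · intro x hx hxN
    obtain ⟨y, hy, hyx⟩ := hA.dom x hx
    have := hxN y hy hyx.symm
    grind

theorem IsHalfMinimum.not_adj_of_isPendantBlock (hA : IsHalfMinimum G A)
    {v v' w a b c y y' z d e f : V} (hP : IsPendantBlock G A v v' w a b c)
    (hQ : IsPendantBlock G A y y' z d e f) : ¬ G.Adj w z := by
  intro hwz
  obtain ⟨h1, h2, h3, h4, h5, h6, h7, h8, h9, h10, h11, h12, h13, h14, h15, h16, h17, h18, h19,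
    h20, h21, h22, h23, h24, h25⟩ := hP
  obtain ⟨k1, k2, k3, k4, k5, k6, k7, k8, k9, k10, k11, k12, k13, k14, k15, k16, k17, k18, k19,
    k20, k21, k22, k23, k24, k25⟩ := hQ
  have hcomm := @G.adj_comm
  have hirr := @G.irrefl
  have hne : w ≠ z := by grind
  have had : a ≠ d := by grind
  have hwy : w ≠ y := by
    rintro rfl
    exact had (h22 d k4 k13).symm
  have hwy' : w ≠ y' := by
    rintro rfl
    exact had (h22 d k4 k16).symm
  have hae : a ≠ e := by grind
  have haf : a ≠ f := by grind
  have hvN : v ≠ y ∧ v ≠ y' ∧ v ≠ z := by grind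
  have hb : b ≠ d ∧ b ≠ e ∧ b ≠ f := by grind
  have hc : c ≠ d ∧ c ≠ e ∧ c ≠ f := by grind
  have hv : ∀ s ∉ A, ¬ G.Adj v s ∧ ¬ G.Adj s v := by grind
  have hv' : ∀ s ∉ A, ¬ G.Adj v' s ∧ ¬ G.Adj s v' := by grind
  have hy : ∀ s ∉ A, ¬ G.Adj y s ∧ ¬ G.Adj s y := by grind
  have hy' : ∀ s ∉ A, ¬ G.Adj y' s ∧ ¬ G.Adj s y' := by grind
  have := hA.card_le_of_exchange (R := {a, b, c, d, e, f}) (T := {v, v', y, y', w})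
    ?_ ?_ ?_ ?_ ?_
  · have hcard : ({a, b, c, d, e, f} : Finset V).card = 6 := by
      rw [Finset.card_insert_of_notMem, Finset.card_insert_of_notMem,
        Finset.card_insert_of_notMem, Finset.card_insert_of_notMem, Finset.card_pair] <;> grind
    have := Finset.card_le_five (a := v) (b := v') (c := y) (d := y') (e := w)
    omega
  all_goals
    simp only [Finset.mem_insert, Finset.mem_singleton, Finset.insert_subset_iff,
      Finset.singleton_subset_iff, forall_eq_or_imp, forall_eq, exists_eq_or_imp, exists_eq_left]
  · grind
  · simp [hv, hv', hy, hy', h2, h3, k1, k2]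
  · grind
  · grind
  · intro x hx hxN
    obtain ⟨y, hy, hyx⟩ := hA.dom x hx
    have := hxN y hy hyx.symm
    grind

theorem IsHalfMinimum.not_adj_of_isSquareBlock (hA : IsHalfMinimum G A)
    {u u' p q z z' r s : V} (hP : IsSquareBlock G A u u' p q)
    (hQ : IsSquareBlock G A z z' r s) : ¬ G.Adj u z := by
  intro huz
  obtain ⟨h1, h2, h3, h4, h5, h6, h7, h8, h9, h10, h11, h12, h13, h14, h15⟩ := hP
  obtain ⟨k1, k2, k3, k4, k5, k6, k7, k8, k9, k10, k11, k12, k13, k14, k15⟩ := hQ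
  have hcomm := @G.adj_comm
  have hirr := @G.irrefl
  have hNu := @degree_le_three_cases _ _ _ _ _ u p q z (hA.le_three u) h8 h9 huz h6
    (by grind) (by grind)
  have hpr : p ≠ r := by grind
  have hps : p ≠ s := by grind
  have hqr : q ≠ r := by grind
  have hqs : q ≠ s := by grind
  have hzz : z' ≠ u := by grind
  have hcard : ({p, q, r, s} : Finset V).card = 4 := by
    rw [Finset.card_insert_of_notMem, Finset.card_insert_of_notMem, Finset.card_pair] <;> grind
  have hu : ∀ s ∉ A, s ≠ z → ¬ G.Adj u s ∧ ¬ G.Adj s u := by grind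
  have huz' : z' ≠ z := k5.symm
  by_cases hz : G.Adj u' z'
  · have := hA.card_le_of_exchange (R := {p, q, r, s}) (T := {u, z'}) ?_ ?_ ?_ ?_ ?_
    · have := Finset.card_le_two (a := u) (b := z')
      omega
    all_goals
      simp only [Finset.mem_insert, Finset.mem_singleton, Finset.insert_subset_iff,
        Finset.singleton_subset_iff, forall_eq_or_imp, forall_eq, exists_eq_or_imp,
        exists_eq_left]
    · grind
    · grind
    · grind
    · grind
    · intro x hx hxN
      obtain ⟨y, hy, hyx⟩ := hA.dom x hx
      have := hxN y hy hyx.symm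
      grind
  · have := hA.card_le_of_exchange (R := {p, q, r, s}) (T := {u, u', z'}) ?_ ?_ ?_ ?_ ?_
    · have := Finset.card_le_three (a := u) (b := u') (c := z')
      omega
    all_goals
      simp only [Finset.mem_insert, Finset.mem_singleton, Finset.insert_subset_iff,
        Finset.singleton_subset_iff, forall_eq_or_imp, forall_eq, exists_eq_or_imp,
        exists_eq_left]
    · grind
    · grind
    · grind
    · grind
    · intro x hx hxN
      obtain ⟨y, hy, hyx⟩ := hA.dom x hx
      have := hxN y hy hyx.symm
      grind

theorem IsHalfMinimum.notMem_level_one (hA : IsHalfMinimum G A) (hK : ¬ HasK33 G A)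
    (w : V) : w ∉ level G A 1 := by
  intro hw
  obtain ⟨v, v', a, b, c, hP⟩ := hA.exists_isPendantBlock_of_level_one hK hw
  obtain ⟨z, hz, hza⟩ := Finset.exists_mem_ne (hA.two_le w) a
  rw [mem_neighborFinset] at hz
  have hzA : z ∉ A := fun h => hza (hP.nbr_w z h hz)
  rcases hA.level_cases hzA with h | h | h
  · obtain ⟨y, y', d, e, f, hQ⟩ := hA.exists_isPendantBlock_of_level_one hK h
    exact hA.not_adj_of_isPendantBlock hP hQ hz
  · obtain ⟨z', p, q, hS⟩ := hA.exists_isSquareBlock hK h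
    exact hA.not_adj_of_isPendantBlock_of_isSquareBlock hP hS hz
  · obtain ⟨-, a', ha', b', hb', c', hc', -, -, -, -, -, -, hN⟩ := hA.level_three_spec h
    have := hP.w_notMem
    rcases hN w hz.symm with rfl | rfl | rfl <;> contradiction

theorem IsHalfMinimum.hasK33 (hA : IsHalfMinimum G A) (hconn : G.Connected)
    (hn : 6 ≤ Fintype.card V) : HasK33 G A := by
  by_contra hK
  have hlev : ∀ u ∉ A, u ∈ level G A 2 := by
    intro u hu
    rcases hA.level_cases hu with h | h | h
    · exact absurd h (hA.notMem_level_one hK u)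
    · exact h
    · obtain ⟨-, w, -, -, -, hw, -⟩ := hA.exists_isPendantBlock hK h
      exact absurd hw (hA.notMem_level_one hK w)
  obtain ⟨u, hu⟩ : ∃ u, u ∉ A := by
    by_contra! h
    have := hA.card
    rw [Finset.eq_univ_of_forall h, Finset.card_univ] at this
    omega
  obtain ⟨u', p, q, hS⟩ := hA.exists_isSquareBlock hK (hlev u hu)
  have closed : ∀ {u u' p q : V}, IsSquareBlock G A u u' p q → ∀ z, G.Adj u z →
      z = p ∨ z = q := by
    intro u u' p q hS z hz
    by_cases hzA : z ∈ A
    · exact hS.nbr_u z hzA hz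
    · obtain ⟨z', r, s, hQ⟩ := hA.exists_isSquareBlock hK (hlev z hzA)
      exact absurd hz (hA.not_adj_of_isSquareBlock hS hQ)
  have hall : ∀ (s t : V) (_ : G.Walk s t), (s = u ∨ s = u' ∨ s = p ∨ s = q) →
      (t = u ∨ t = u' ∨ t = p ∨ t = q) := by
    intro s t w
    induction w with
    | nil => exact id
    | cons hadj _ ih =>
      have := closed hS
      have := closed hS.symm
      have := hS.nbr_p
      have := hS.nbr_q
      intro hs
      apply ih
      grind
  have hsub : (Finset.univ : Finset V) ⊆ {u, u', p, q} := by
    intro t _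
    obtain ⟨w⟩ := hconn.preconnected u t
    simpa using hall u t w (Or.inl rfl)
  have := Finset.card_le_card hsub
  have := Finset.card_le_four (a := u) (b := u') (c := p) (d := q)
  rw [Finset.card_univ] at *
  omega

end

theorem exists_isIndepDomSet_ncard {V : Type*} [Finite V] (G : SimpleGraph V)
    (h : indepDomNum G ≠ 0) : ∃ S : Set V, IsIndepDomSet G S ∧ S.ncard = indepDomNum G := by
  unfold indepDomNum at h ⊢
  exact Nat.sInf_mem (Nat.nonempty_of_pos_sInf (Nat.pos_of_ne_zero h))

/-- Let `G` be a connected subcubic graph of even order `n ≥ 6` with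
`i(G) = n/2`.  If `G` has no support vertex (no vertex adjacent to a vertex of
degree 1), then `G ≅ K_{3,3}`. -/
theorem stmt_10 {V : Type*} [Fintype V] (G : SimpleGraph V)
    (hconn : G.Connected) (hsub : ∀ v : V, Nat.card (G.neighborSet v) ≤ 3)
    (hn : 6 ≤ Fintype.card V) (heven : Even (Fintype.card V))
    (hi : 2 * indepDomNum G = Fintype.card V)
    (hsupp : ¬ ∃ v u : V, G.Adj v u ∧ Nat.card (G.neighborSet u) = 1) :
    Nonempty (G ≃g completeBipartiteGraph (Fin 3) (Fin 3)) := by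
  classical
  obtain ⟨S, hS, hcard⟩ := exists_isIndepDomSet_ncard G (by omega)
  have hdeg : ∀ v, Nat.card (G.neighborSet v) = G.degree v := fun v => by
    rw [Nat.card_eq_fintype_card, card_neighborSet_eq_degree]
  simp only [hdeg] at hsub hsupp
  have : Nontrivial V := Fintype.one_lt_card_iff_nontrivial.1 (by omega)
  have hA : IsHalfMinimum G S.toFinset :=
    { dom := by simpa using hS.1
      ind := by simpa using hS.2
      min := by
        intro T hT hT'
        rw [← Set.ncard_eq_toFinset_card', hcard]
        exact Nat.sInf_le ⟨T, ⟨by simpa using hT, by simpa using hT'⟩, Set.ncard_coe_finset T⟩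
      card := by rw [← Set.ncard_eq_toFinset_card', hcard, hi]
      two_le := by
        intro v
        have hpos := hconn.preconnected.degree_pos_of_nontrivial v
        obtain ⟨u, hu⟩ := (G.degree_pos_iff_exists_adj v).1 hpos
        have : G.degree v ≠ 1 := fun h => hsupp ⟨u, v, hu.symm, h⟩
        omega
      le_three := hsub }
  exact hA.iso_of_hasK33 hconn (hA.hasK33 hconn hn)
end

section
/- Let G be a connected subcubic graph of even order n ≥ 6 with i(G) = n/2. If G contains a support vertex with two leaf neighbors, then G is isomorphic to the double star S(2,2). -/
open SimpleGraph

open Classical in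
/-- In a finite subcubic graph every vertex set `W` contains an independent set dominating `W`
whose size is at most half of `|W|` plus the number of isolated vertices of `G[W]`. -/
theorem exists_indep_dominating_two_mul_card_le {V : Type*} [Fintype V] (G : SimpleGraph V)
    (hdeg : ∀ v (t : Finset V), (∀ y ∈ t, G.Adj v y) → t.card ≤ 3) (W : Finset V) :
    ∃ S ⊆ W, (∀ v ∈ W, v ∉ S → ∃ u ∈ S, G.Adj u v) ∧ (∀ u ∈ S, ∀ v ∈ S, ¬ G.Adj u v) ∧
      2 * S.card ≤ W.card + (W.filter fun y => ∀ z ∈ W, ¬ G.Adj y z).card := by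
  let P : Finset V × Finset V → Prop := fun p =>
    p.1 ∪ p.2 ⊆ W ∧ (∀ u ∈ p.1, ∀ v ∈ p.1, ¬ G.Adj u v) ∧ ∀ u ∈ p.2, ∀ v ∈ p.2, ¬ G.Adj u v
  obtain ⟨⟨A, B⟩, hAB, hmax⟩ := Finset.exists_max_image (Finset.univ.filter P)
    (fun p => (p.1 ∪ p.2).card) ⟨(∅, ∅), by simp [P]⟩
  obtain ⟨hW, hA, hB⟩ : P (A, B) := (Finset.mem_filter.mp hAB).2
  replace hmax : ∀ A' B' : Finset V, P (A', B') → (A' ∪ B').card ≤ (A ∪ B).card :=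
    fun A' B' h => hmax (A', B') (by simpa using h)
  simp only at hW hA hB
  let I := (A ∪ B).filter fun y => ∀ z ∈ A ∪ B, ¬ G.Adj y z
  let X := A \ I
  let Y := B \ I
  have hI : ∀ y, y ∈ I ↔ y ∈ A ∪ B ∧ ∀ z ∈ A ∪ B, ¬ G.Adj y z := by simp [I]
  have hX : ∀ y, y ∈ X ↔ y ∈ A ∧ y ∉ I := by simp [X]
  have hY : ∀ y, y ∈ Y ↔ y ∈ B ∧ y ∉ I := by simp [Y]
  have hHW : ∀ y, y ∈ A ∪ B → y ∈ W := fun y hy => hW hy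
  clear_value I X Y
  have hunion : X ∪ (Y ∪ I) = A ∪ B := by ext y; grind
  have hdisj : Disjoint X Y := by
    rw [Finset.disjoint_left]
    intro y h1 h2
    have := hI y
    grind
  have hXI : Disjoint X I := by rw [Finset.disjoint_left]; grind
  have hYI : Disjoint Y I := by rw [Finset.disjoint_left]; grind
  have indX : ∀ u ∈ X ∪ I, ∀ v ∈ X ∪ I, ¬ G.Adj u v := by
    have := fun u v => G.adj_comm u v
    grind
  have indY : ∀ u ∈ Y ∪ I, ∀ v ∈ Y ∪ I, ¬ G.Adj u v := by
    have := fun u v => G.adj_comm u v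
    grind
  have domX : ∀ c ∈ W, c ∉ A ∪ B → ∃ u ∈ X, G.Adj u c := by
    intro c hc hcH
    by_contra! hno
    have hP : P (insert c X, Y ∪ I) := by
      refine ⟨?_, ?_, indY⟩
      · intro y; grind
      · have := fun u v => G.adj_comm u v
        have := G.irrefl (v := c)
        grind
    have := hmax _ _ hP
    rw [Finset.insert_union, hunion, Finset.card_insert_of_notMem hcH] at this
    omega
  have domY : ∀ c ∈ W, c ∉ A ∪ B → ∃ u ∈ Y, G.Adj u c := by
    intro c hc hcH
    by_contra! hno
    have hP : P (X ∪ I, insert c Y) := by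
      refine ⟨?_, indX, ?_⟩
      · intro y; grind
      · have := fun u v => G.adj_comm u v
        have := G.irrefl (v := c)
        grind
    have := hmax _ _ hP
    rw [Finset.union_insert, Finset.union_assoc, Finset.union_comm I Y, hunion,
      Finset.card_insert_of_notMem hcH] at this
    omega
  have hcard : I.card ≤ (W \ (A ∪ B)).card +
      (W.filter fun y => ∀ z ∈ W, ¬ G.Adj y z).card := by
    set J := W.filter fun y => ∀ z ∈ W, ¬ G.Adj y z with hJ
    have hnbr : ∀ y ∈ I \ J, ∃ c ∈ W \ (A ∪ B), G.Adj y c := by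
      intro y hy
      simp only [hJ, Finset.mem_sdiff, Finset.mem_filter] at hy ⊢
      grind
    choose! f hf hfadj using hnbr
    have hinj : Set.InjOn f (I \ J : Finset V) := by
      intro y hy z hz hyz
      by_contra hne
      have h1 := hf y hy
      rw [Finset.mem_sdiff] at h1
      obtain ⟨a, ha, hac⟩ := domX _ h1.1 h1.2
      obtain ⟨b, hb, hbc⟩ := domY _ h1.1 h1.2
      have h2 := hfadj y hy
      have h3 := hfadj z hz
      rw [← hyz] at h3
      have hyI := (Finset.mem_sdiff.mp hy).1
      have hzI := (Finset.mem_sdiff.mp hz).1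
      have hab : a ≠ b := fun h => Finset.disjoint_left.mp hdisj ha (h ▸ hb)
      have h4 := hdeg (f y) {a, b, y, z} (by simp [hac.symm, hbc.symm, h2.symm, h3.symm])
      have : ({a, b, y, z} : Finset V).card = 4 := by
        rw [Finset.card_insert_of_notMem, Finset.card_insert_of_notMem,
          Finset.card_pair hne] <;> grind
      omega
    have h1 := Finset.card_le_card_of_injOn f hf hinj
    have h2 := Finset.card_le_card_sdiff_add_card (s := I) (t := J)
    omega
  have hsum : (X ∪ I).card + (Y ∪ I).card = (A ∪ B).card + I.card := by
    rw [← hunion, Finset.card_union_of_disjoint hXI, Finset.card_union_of_disjoint hYI,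
      Finset.card_union_of_disjoint (Finset.disjoint_union_right.mpr ⟨hdisj, hXI⟩),
      Finset.card_union_of_disjoint hYI]
    omega
  have hsd := Finset.card_sdiff_add_card_eq_card hW
  have hsymm := fun u v => G.adj_comm u v
  rcases le_total (X ∪ I).card (Y ∪ I).card with hle | hle
  · refine ⟨X ∪ I, by intro y; grind, ?_, indX, by omega⟩
    intro v hv hvS
    by_cases hvH : v ∈ A ∪ B
    · have h1 : v ∉ I := by grind
      have h2 : v ∈ B := by grind
      have h3 := hI v
      simp only [hvH, h1, true_and, false_iff, not_forall, not_not] at h3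
      obtain ⟨z, hz, hvz⟩ := h3
      exact ⟨z, by grind, hvz.symm⟩
    · obtain ⟨u, hu, huv⟩ := domX v hv hvH
      exact ⟨u, by grind, huv⟩
  · refine ⟨Y ∪ I, by intro y; grind, ?_, indY, by omega⟩
    intro v hv hvS
    by_cases hvH : v ∈ A ∪ B
    · have h1 : v ∉ I := by grind
      have h2 : v ∈ A := by grind
      have h3 := hI v
      simp only [hvH, h1, true_and, false_iff, not_forall, not_not] at h3
      obtain ⟨z, hz, hvz⟩ := h3
      exact ⟨z, by grind, hvz.symm⟩
    · obtain ⟨u, hu, huv⟩ := domY v hv hvH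
      exact ⟨u, by grind, huv⟩

/-- A nonempty set closed under adjacency is everything in a connected graph. -/
theorem SimpleGraph.Connected.mem_of_adj_closed {V : Type*} {G : SimpleGraph V}
    (hconn : G.Connected) {s : Set V} {a : V} (ha : a ∈ s)
    (hs : ∀ y ∈ s, ∀ z, G.Adj y z → z ∈ s) (b : V) : b ∈ s := by
  obtain ⟨p⟩ := hconn.preconnected a b
  induction p with
  | nil => exact ha
  | cons h _ ih => exact ih (hs _ ha _ h)

theorem SimpleGraph.card_le_natCard_neighborSet {V : Type*} [Finite V] (G : SimpleGraph V)
    (v : V) (t : Finset V) (h : ∀ y ∈ t, G.Adj v y) : t.card ≤ Nat.card (G.neighborSet v) := by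
  rw [Nat.card_coe_set_eq, ← Set.ncard_coe_finset]
  exact Set.ncard_le_ncard (fun y hy => h y hy)

/-- Let `G` be a connected subcubic graph of even order `n ≥ 6` with
`i(G) = n/2`.  If `G` has a support vertex with two leaf neighbors, then
`G ≅ S(2,2)`. -/
theorem stmt_11 {V : Type*} [Fintype V] (G : SimpleGraph V)
    (hconn : G.Connected) (hsub : ∀ v : V, Nat.card (G.neighborSet v) ≤ 3)
    (hn : 6 ≤ Fintype.card V) (heven : Even (Fintype.card V))
    (hi : 2 * indepDomNum G = Fintype.card V)
    (hsupp : ∃ v u w : V, u ≠ w ∧ G.Adj v u ∧ G.Adj v w ∧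
      Nat.card (G.neighborSet u) = 1 ∧ Nat.card (G.neighborSet w) = 1) :
    Nonempty (G ≃g doubleStar22) := by
  classical
  obtain ⟨v, u, w, huw, hvu, hvw, hu, hw⟩ := hsupp
  have hdeg : ∀ v (t : Finset V), (∀ y ∈ t, G.Adj v y) → t.card ≤ 3 := fun v t h =>
    (G.card_le_natCard_neighborSet v t h).trans (hsub v)
  have hleaf : ∀ l y : V, Nat.card (G.neighborSet l) = 1 → G.Adj v l → G.Adj l y → y = v := by
    intro l y hl hvl hly
    by_contra hne
    have := G.card_le_natCard_neighborSet l {y, v} (by simp [hly, hvl.symm])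
    rw [Finset.card_pair hne] at this
    omega
  have hu' : ∀ y, G.Adj u y → y = v := fun y => hleaf u y hu hvu
  have hw' : ∀ y, G.Adj w y → y = v := fun y => hleaf w y hw hvw
  have hdeg4 : ∀ z a b c y : V, a ≠ b → a ≠ c → b ≠ c → G.Adj z a → G.Adj z b → G.Adj z c →
      G.Adj z y → y = a ∨ y = b ∨ y = c := by
    intro z a b c y hab hac hbc ha hb hc hy
    by_contra! hne
    have h4 := hdeg z {y, a, b, c} (by simp [*])
    have : ({y, a, b, c} : Finset V).card = 4 := by
      rw [Finset.card_insert_of_notMem, Finset.card_insert_of_notMem,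
        Finset.card_pair hbc] <;> simp [*]
    omega
  have hfull : ∀ s : Finset V, v ∈ s → (∀ y ∈ s, ∀ z, G.Adj y z → z ∈ s) → s = Finset.univ :=
    fun s hv hs => Finset.eq_univ_of_forall fun b =>
      hconn.mem_of_adj_closed (s := (s : Set V)) (by simpa using hv) (by simpa using hs) b
  obtain ⟨x, hvx, hxu, hxw⟩ : ∃ x, G.Adj v x ∧ x ≠ u ∧ x ≠ w := by
    by_contra! hno
    have h1 := hfull {v, u, w} (by simp) (by grind)
    have h2 : ({v, u, w} : Finset V).card ≤ 3 := Finset.card_le_three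
    rw [h1, Finset.card_univ] at h2
    omega
  have hvN : ∀ y, G.Adj v y → y = u ∨ y = w ∨ y = x := fun y =>
    hdeg4 v u w x y huw hxu.symm hxw.symm hvu hvw hvx
  have hvu' := hvu.ne
  have hvw' := hvw.ne
  have hvx' := hvx.ne
  have hcardT : ({v, u, w, x} : Finset V).card = 4 := by
    rw [Finset.card_insert_of_notMem, Finset.card_insert_of_notMem,
      Finset.card_pair hxw.symm] <;> grind
  set W : Finset V := ({v, u, w, x} : Finset V)ᶜ with hWdef
  have hW : ∀ y, y ∈ W ↔ y ≠ v ∧ y ≠ u ∧ y ≠ w ∧ y ≠ x := by simp [hWdef]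
  have hWcard : W.card = Fintype.card V - 4 := by rw [hWdef, Finset.card_compl, hcardT]
  obtain ⟨S, hSW, hSdom, hSind, hScard⟩ := exists_indep_dominating_two_mul_card_le G hdeg W
  have hle : indepDomNum G ≤ S.card + 1 := by
    have hvS : v ∉ S := fun h => by have := hSW h; simp [hW] at this
    rw [← Finset.card_insert_of_notMem hvS, ← Set.ncard_coe_finset]
    refine Nat.sInf_le ⟨_, ⟨?_, ?_⟩, rfl⟩
    · intro y hy
      simp only [Finset.mem_coe, Finset.mem_insert, not_or] at hy ⊢
      by_cases hyW : y ∈ W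
      · obtain ⟨z, hz, hzy⟩ := hSdom y hyW hy.2
        exact ⟨z, Or.inr hz, hzy⟩
      · refine ⟨v, Or.inl rfl, ?_⟩
        rw [hW] at hyW
        clear hdeg4 hfull hdeg hleaf
        grind
    · have hvS' : ∀ y ∈ S, ¬ G.Adj v y := fun y hy h => by
        obtain ⟨-, h1, h2, h3⟩ := (hW y).1 (hSW hy)
        rcases hvN y h with rfl | rfl | rfl <;> contradiction
      intro y hy z hz
      simp only [Finset.mem_coe, Finset.mem_insert] at hy hz
      rcases hy with rfl | hy <;> rcases hz with rfl | hz
      exacts [G.irrefl, hvS' z hz, fun h => hvS' y hy h.symm, hSind y hy z hz]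
  obtain ⟨p, hp, q, hq, hpq⟩ := Finset.one_lt_card.mp
    (show 1 < (W.filter fun y => ∀ z ∈ W, ¬ G.Adj y z).card by omega)
  have hiso : ∀ y, y ∈ (W.filter fun y => ∀ z ∈ W, ¬ G.Adj y z) →
      y ∈ W ∧ G.Adj x y ∧ ∀ z, G.Adj y z → z = x := by
    intro y hy
    obtain ⟨hyW, hy⟩ := Finset.mem_filter.mp hy
    have honly : ∀ z, G.Adj y z → z = x := by
      intro z hyz
      by_contra hzx
      obtain ⟨h1, h2, h3, h4⟩ := (hW y).1 hyW
      have hzW : ¬ z ∈ W := fun hz => hy z hz hyz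
      have := hyz.symm
      rw [hW] at hzW
      clear hdeg4 hfull hdeg hleaf
      grind
    have : Nontrivial V := ⟨v, u, hvu'⟩
    obtain ⟨z, hz⟩ := hconn.preconnected.exists_adj_of_nontrivial y
    exact ⟨hyW, honly z hz ▸ hz.symm, honly⟩
  obtain ⟨hpW, hxp, hpx⟩ := hiso p hp
  obtain ⟨hqW, hxq, hqx⟩ := hiso q hq
  obtain ⟨hpv, hpu, hpw, hpx'⟩ := (hW p).1 hpW
  obtain ⟨hqv, hqu, hqw, hqx'⟩ := (hW q).1 hqW
  have hxN : ∀ y, G.Adj x y → y = v ∨ y = p ∨ y = q := fun y =>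
    hdeg4 x v p q y hpv.symm hqv.symm hpq hvx.symm hxp hxq
  have huniv := hfull {v, x, u, w, p, q} (by simp) (by
    intro y hy z hyz
    simp only [Finset.mem_insert, Finset.mem_singleton] at hy ⊢
    clear hdeg4 hfull hdeg hleaf hiso hSdom hSind hW
    grind)
  clear hdeg4 hfull hdeg hleaf hiso hSdom hSind hW
  let f : Fin 6 → V := ![v, x, u, w, p, q]
  have hadj : ∀ i j, G.Adj (f i) (f j) ↔ doubleStar22.Adj i j := by
    have hsymm := fun a b => G.adj_comm a b
    have hirr := fun a => G.irrefl (v := a)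
    intro i j
    fin_cases i <;> fin_cases j <;> simp [f, doubleStar22] <;> grind
  have hbij : Function.Bijective f := by
    constructor
    · intro i j hij
      fin_cases i <;> fin_cases j <;> simp [f] at hij ⊢ <;> grind
    · intro y
      have hy : y ∈ ({v, x, u, w, p, q} : Finset V) := huniv ▸ Finset.mem_univ y
      simp only [Finset.mem_insert, Finset.mem_singleton] at hy
      rcases hy with rfl | rfl | rfl | rfl | rfl | rfl
      exacts [⟨0, rfl⟩, ⟨1, rfl⟩, ⟨2, rfl⟩, ⟨3, rfl⟩, ⟨4, rfl⟩, ⟨5, rfl⟩]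
  exact ⟨(RelIso.mk (Equiv.ofBijective f hbij) (fun {i j} => hadj i j)).symm⟩
end

section
/- Let G be a cubic graph containing eight distinct vertices a_1, a_2, b_1, b_2, b_3, c_1, c_2, c_3 such that: a_i is adjacent to b_j for all i ∈ {1,2} and j ∈ {1,2,3}; c_j is adjacent to b_j for each j ∈ {1,2,3}; c_2 is adjacent to c_3; for j ∈ {1,2}, the vertex c_j has exactly one neighbor outside the set X = {a_1,a_2,b_1,b_2,b_3,c_1,c_2,c_3}, call it c_j'; and c_1' is adjacent to c_2' in G. Then every independent dominating set S of G satisfies |S ∩ X| ≥ 3. -/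
/-- In a cubic graph, three distinct neighbors of a vertex are all of its neighbors. -/
theorem adj_eq_of_card_three {V : Type*} (G : SimpleGraph V) {x p q r v : V}
    (hx : Nat.card (G.neighborSet x) = 3) (hp : G.Adj x p) (hq : G.Adj x q) (hr : G.Adj x r)
    (hpq : p ≠ q) (hpr : p ≠ r) (hqr : q ≠ r) (hv : G.Adj x v) : v = p ∨ v = q ∨ v = r := by
  have hx' : (G.neighborSet x).ncard = 3 := hx
  have hfin : (G.neighborSet x).Finite := Set.finite_of_ncard_ne_zero (by omega)
  have hsub : ({p, q, r} : Set V) ⊆ G.neighborSet x := by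
    rintro y (rfl | rfl | rfl) <;> assumption
  have hcard : ({p, q, r} : Set V).ncard = 3 := Set.ncard_eq_three.2 ⟨p, q, r, hpq, hpr, hqr, rfl⟩
  have heq := Set.eq_of_subset_of_ncard_le hsub (by omega) hfin
  have hmem : v ∈ ({p, q, r} : Set V) := heq ▸ hv
  simpa using hmem

/-- In a cubic graph, a vertex has a neighbor other than two prescribed vertices. -/
theorem exists_adj_ne_ne_of_card_three {V : Type*} (G : SimpleGraph V) {x : V} (p q : V)
    (hx : Nat.card (G.neighborSet x) = 3) : ∃ v, G.Adj x v ∧ v ≠ p ∧ v ≠ q := by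
  by_contra! h
  have hsub : G.neighborSet x ⊆ ({p, q} : Set V) := by
    intro v hv
    by_cases hp : v = p
    · simp [hp]
    · simp [h v hv hp]
  have hle := Set.ncard_le_ncard hsub (Set.toFinite _)
  have hpair := Set.ncard_insert_le p {q}
  rw [Set.ncard_singleton] at hpair
  have hx' : (G.neighborSet x).ncard = 3 := hx
  omega

/-- A finite set containing three distinct elements has at least three elements. -/
theorem three_le_ncard_of_mem {V : Type*} {T : Set V} (hT : T.Finite) {p q r : V}
    (hp : p ∈ T) (hq : q ∈ T) (hr : r ∈ T) (hpq : p ≠ q) (hpr : p ≠ r) (hqr : q ≠ r) :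
    3 ≤ T.ncard := by
  rw [← Set.ncard_eq_three.2 ⟨p, q, r, hpq, hpr, hqr, rfl⟩]
  refine Set.ncard_le_ncard ?_ hT
  rintro y (rfl | rfl | rfl) <;> assumption


open SimpleGraph

/-- An `X`-copy in a cubic graph `G`: eight distinct vertices with `aᵢ`
adjacent to every `bⱼ`, `cⱼ` adjacent to `bⱼ`, `c₂` adjacent to `c₃`, where
for `j = 1, 2` the vertex `cⱼ` has a unique neighbor `cⱼ'` outside
`X = {a₁, a₂, b₁, b₂, b₃, c₁, c₂, c₃}`, and `c₁'` is adjacent to `c₂'`.  Then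
every independent dominating set `S` satisfies `|S ∩ X| ≥ 3`. -/
theorem stmt_12 {V : Type*} (G : SimpleGraph V)
    (hcubic : ∀ v : V, Nat.card (G.neighborSet v) = 3)
    (a₁ a₂ b₁ b₂ b₃ c₁ c₂ c₃ c₁' c₂' : V)
    (hdist : List.Nodup [a₁, a₂, b₁, b₂, b₃, c₁, c₂, c₃])
    (X : Set V) (hX : X = {a₁, a₂, b₁, b₂, b₃, c₁, c₂, c₃})
    (hab : ∀ a ∈ ({a₁, a₂} : Set V), ∀ b ∈ ({b₁, b₂, b₃} : Set V), G.Adj a b)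
    (hcb₁ : G.Adj c₁ b₁) (hcb₂ : G.Adj c₂ b₂) (hcb₃ : G.Adj c₃ b₃)
    (hcc : G.Adj c₂ c₃)
    (hc₁'mem : c₁' ∉ X) (hc₁'adj : G.Adj c₁ c₁')
    (hc₁'uniq : ∀ v, G.Adj c₁ v → v ∉ X → v = c₁')
    (hc₂'mem : c₂' ∉ X) (hc₂'adj : G.Adj c₂ c₂')
    (hc₂'uniq : ∀ v, G.Adj c₂ v → v ∉ X → v = c₂')
    (hcc' : G.Adj c₁' c₂')
    (S : Set V) (hS : IsIndepDomSet G S) :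
    3 ≤ (S ∩ X).ncard := by
  have hfin : (S ∩ X).Finite := by
    rw [hX]
    exact (Set.toFinite _).inter_of_right _
  obtain ⟨hdom, hind⟩ := hS
  have h11 : G.Adj a₁ b₁ := hab a₁ (by simp) b₁ (by simp)
  have h12 : G.Adj a₁ b₂ := hab a₁ (by simp) b₂ (by simp)
  have h13 : G.Adj a₁ b₃ := hab a₁ (by simp) b₃ (by simp)
  have h21 : G.Adj a₂ b₁ := hab a₂ (by simp) b₁ (by simp)
  have h22 : G.Adj a₂ b₂ := hab a₂ (by simp) b₂ (by simp)
  have h23 : G.Adj a₂ b₃ := hab a₂ (by simp) b₃ (by simp)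
  have hmem : ∀ v, v ∈ X ↔
      v = a₁ ∨ v = a₂ ∨ v = b₁ ∨ v = b₂ ∨ v = b₃ ∨ v = c₁ ∨ v = c₂ ∨ v = c₃ := by
    intro v
    simp [hX]
  simp only [List.nodup_cons, List.mem_cons, List.not_mem_nil, or_false, not_or,
    not_false_eq_true, List.nodup_nil, and_true] at hdist
  obtain ⟨⟨ha, ha₁b₁, ha₁b₂, ha₁b₃, ha₁c₁, ha₁c₂, ha₁c₃⟩,
    ⟨ha₂b₁, ha₂b₂, ha₂b₃, ha₂c₁, ha₂c₂, ha₂c₃⟩,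
    ⟨hb₁b₂, hb₁b₃, hb₁c₁, hb₁c₂, hb₁c₃⟩, ⟨hb₂b₃, hb₂c₁, hb₂c₂, hb₂c₃⟩,
    ⟨hb₃c₁, hb₃c₂, hb₃c₃⟩, ⟨hc₁c₂, hc₁c₃⟩, hc₂c₃⟩ := hdist
  have na₁ : ∀ v, G.Adj a₁ v → v = b₁ ∨ v = b₂ ∨ v = b₃ := fun v hv =>
    adj_eq_of_card_three G (hcubic a₁) h11 h12 h13 hb₁b₂ hb₁b₃ hb₂b₃ hv
  have na₂ : ∀ v, G.Adj a₂ v → v = b₁ ∨ v = b₂ ∨ v = b₃ := fun v hv =>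
    adj_eq_of_card_three G (hcubic a₂) h21 h22 h23 hb₁b₂ hb₁b₃ hb₂b₃ hv
  have nb₁ : ∀ v, G.Adj b₁ v → v = a₁ ∨ v = a₂ ∨ v = c₁ := fun v hv =>
    adj_eq_of_card_three G (hcubic b₁) h11.symm h21.symm hcb₁.symm ha ha₁c₁ ha₂c₁ hv
  have nb₂ : ∀ v, G.Adj b₂ v → v = a₁ ∨ v = a₂ ∨ v = c₂ := fun v hv =>
    adj_eq_of_card_three G (hcubic b₂) h12.symm h22.symm hcb₂.symm ha ha₁c₂ ha₂c₂ hv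
  have nb₃ : ∀ v, G.Adj b₃ v → v = a₁ ∨ v = a₂ ∨ v = c₃ := fun v hv =>
    adj_eq_of_card_three G (hcubic b₃) h13.symm h23.symm hcb₃.symm ha ha₁c₃ ha₂c₃ hv
  have nc₂ : ∀ v, G.Adj c₂ v → v = b₂ ∨ v = c₃ ∨ v = c₂' := fun v hv =>
    adj_eq_of_card_three G (hcubic c₂) hcb₂ hcc hc₂'adj hb₂c₃
      (by grind) (by grind) hv
  have hc₁₃ : G.Adj c₁ c₃ := by
    obtain ⟨v, hv, hvb, hvc⟩ := exists_adj_ne_ne_of_card_three G b₁ c₁' (hcubic c₁)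
    have hvX : v ∈ X := by
      by_contra h
      exact hvc (hc₁'uniq v hv h)
    rcases (hmem v).1 hvX with rfl | rfl | rfl | rfl | rfl | rfl | rfl | rfl
    · have := na₁ c₁ hv.symm
      grind
    · have := na₂ c₁ hv.symm
      grind
    · exact absurd rfl hvb
    · have := nb₂ c₁ hv.symm
      grind
    · have := nb₃ c₁ hv.symm
      grind
    · exact absurd hv (G.irrefl)
    · have := nc₂ c₁ hv.symm
      grind
    · exact hv
  have nc₃ : ∀ v, G.Adj c₃ v → v = b₃ ∨ v = c₂ ∨ v = c₁ := fun v hv =>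
    adj_eq_of_card_three G (hcubic c₃) hcb₃ hcc.symm hc₁₃.symm hb₃c₂ hb₃c₁ (Ne.symm hc₁c₂) hv
  have hdom' : ∀ v, v ∈ S ∨ ∃ u ∈ S, G.Adj v u := by
    intro v
    by_cases hv : v ∈ S
    · exact Or.inl hv
    · obtain ⟨u, hu, huv⟩ := hdom v hv
      exact Or.inr ⟨u, hu, huv.symm⟩
  by_cases hA : a₁ ∈ S ∨ a₂ ∈ S
  · have hb₁ : b₁ ∉ S := fun h => hA.elim (hind _ · _ h h11) (hind _ · _ h h21)
    have hb₂ : b₂ ∉ S := fun h => hA.elim (hind _ · _ h h12) (hind _ · _ h h22)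
    have hb₃ : b₃ ∉ S := fun h => hA.elim (hind _ · _ h h13) (hind _ · _ h h23)
    have ha₁S : a₁ ∈ S := by
      rcases hdom' a₁ with h | ⟨u, hu, hadj⟩
      · exact h
      · rcases na₁ u hadj with rfl | rfl | rfl <;> contradiction
    have ha₂S : a₂ ∈ S := by
      rcases hdom' a₂ with h | ⟨u, hu, hadj⟩
      · exact h
      · rcases na₂ u hadj with rfl | rfl | rfl <;> contradiction
    have key : ∀ c ∈ S, (c = c₁ ∨ c = c₂ ∨ c = c₃) → 3 ≤ (S ∩ X).ncard := fun c hc h =>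
      three_le_ncard_of_mem hfin (p := a₁) (q := a₂) (r := c)
        ⟨ha₁S, (hmem _).2 (by simp)⟩ ⟨ha₂S, (hmem _).2 (by simp)⟩
        ⟨hc, (hmem _).2 (by rcases h with h | h | h <;> simp [h])⟩
        ha (by grind) (by grind)
    rcases hdom' c₃ with h | ⟨u, hu, hadj⟩
    · exact key c₃ h (by simp)
    · rcases nc₃ u hadj with rfl | rfl | rfl
      · contradiction
      · exact key _ hu (by simp)
      · exact key _ hu (by simp)
  · push Not at hA
    have pick : ∀ b c, (∀ v, G.Adj b v → v = a₁ ∨ v = a₂ ∨ v = c) → ∃ u ∈ S, u = b ∨ u = c := by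
      intro b c hb
      rcases hdom' b with h | ⟨u, hu, hadj⟩
      · exact ⟨b, h, Or.inl rfl⟩
      · rcases hb u hadj with rfl | rfl | rfl
        · exact absurd hu hA.1
        · exact absurd hu hA.2
        · exact ⟨u, hu, Or.inr rfl⟩
    obtain ⟨u₁, hu₁, h₁⟩ := pick b₁ c₁ nb₁
    obtain ⟨u₂, hu₂, h₂⟩ := pick b₂ c₂ nb₂
    obtain ⟨u₃, hu₃, h₃⟩ := pick b₃ c₃ nb₃
    exact three_le_ncard_of_mem hfin
      ⟨hu₁, (hmem _).2 (by rcases h₁ with h | h <;> simp [h])⟩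
      ⟨hu₂, (hmem _).2 (by rcases h₂ with h | h <;> simp [h])⟩
      ⟨hu₃, (hmem _).2 (by rcases h₃ with h | h <;> simp [h])⟩
      (by grind) (by grind) (by grind)
end

section
/- For every integer k ≥ 1 there exists a connected cubic graph G of order 8k with independent domination number i(G) = 3k. -/
open SimpleGraph

theorem IsIndepDomSet.image_iso {V W : Type*} {G : SimpleGraph V} {H : SimpleGraph W} (e : G ≃g H)
    {S : Set V} (hS : IsIndepDomSet G S) : IsIndepDomSet H (e '' S) := by
  refine ⟨fun v hv => ?_, ?_⟩
  · obtain ⟨u, hu, huv⟩ := hS.1 (e.symm v) fun h => hv ⟨_, h, e.apply_symm_apply v⟩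
    refine ⟨e u, ⟨u, hu, rfl⟩, ?_⟩
    rw [← e.map_adj_iff] at huv
    rwa [e.apply_symm_apply] at huv
  · rintro _ ⟨u, hu, rfl⟩ _ ⟨v, hv, rfl⟩ h
    exact hS.2 u hu v hv (e.map_adj_iff.1 h)

theorem indepDomNum_congr {V W : Type*} {G : SimpleGraph V} {H : SimpleGraph W} (e : G ≃g H) :
    indepDomNum G = indepDomNum H := by
  unfold indepDomNum
  congr 1
  ext k
  constructor
  · rintro ⟨S, hS, rfl⟩
    exact ⟨_, hS.image_iso e, Set.ncard_image_of_injective S e.injective⟩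
  · rintro ⟨S, hS, rfl⟩
    exact ⟨_, hS.image_iso e.symm, Set.ncard_image_of_injective S e.symm.injective⟩

theorem indepDomNum_eq {V : Type*} {G : SimpleGraph V} {S : Set V} (hS : IsIndepDomSet G S)
    (hmin : ∀ T, IsIndepDomSet G T → S.ncard ≤ T.ncard) : indepDomNum G = S.ncard := by
  refine IsLeast.csInf_eq ⟨⟨S, hS, rfl⟩, ?_⟩
  rintro _ ⟨T, hT, rfl⟩
  exact hmin T hT

/-- The ordered edges of `block`. -/
def blockEdges : List (Fin 8 × Fin 8) :=
  [(0, 1), (0, 2), (1, 3), (1, 4), (2, 5), (2, 7), (3, 5), (3, 6), (4, 5), (4, 6), (6, 7)]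

/-- A graph of order `8` in which `0` and `7` have degree `2` and all other vertices have
degree `3`. -/
def block : SimpleGraph (Fin 8) where
  Adj u v := (u, v) ∈ blockEdges ∨ (v, u) ∈ blockEdges
  symm := ⟨fun _ _ => Or.symm⟩
  loopless := ⟨by decide⟩

instance : DecidableRel block.Adj := fun u v =>
  inferInstanceAs (Decidable ((u, v) ∈ blockEdges ∨ (v, u) ∈ blockEdges))

/-- Copies of `block` indexed by `α`, the vertex `7` of the `i`-th copy being joined to the
vertex `0` of the `σ i`-th copy. -/
def blockChain {α : Type*} (σ : Equiv.Perm α) : SimpleGraph (Fin 8 × α) where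
  Adj x y := (x.2 = y.2 ∧ block.Adj x.1 y.1) ∨ (x.1 = 7 ∧ y.1 = 0 ∧ y.2 = σ x.2) ∨
    (x.1 = 0 ∧ y.1 = 7 ∧ x.2 = σ y.2)
  symm := ⟨fun x y h => by
    rcases h with ⟨h, h'⟩ | ⟨h, h', h''⟩ | ⟨h, h', h''⟩
    · exact Or.inl ⟨h.symm, h'.symm⟩
    · exact Or.inr (Or.inr ⟨h', h, h''⟩)
    · exact Or.inr (Or.inl ⟨h', h, h''⟩)⟩
  loopless := ⟨fun x h => by
    rcases h with ⟨-, h⟩ | ⟨h, h', -⟩ | ⟨h, h', -⟩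
    · exact h.ne rfl
    · exact absurd (h.symm.trans h') (by decide)
    · exact absurd (h.symm.trans h') (by decide)⟩

theorem block_connected : block.Connected := by
  have h : ∀ u, block.Adj 0 u ∨ (∃ v, block.Adj 0 v ∧ block.Adj v u) ∨
      ∃ v w, block.Adj 0 v ∧ block.Adj v w ∧ block.Adj w u := by decide
  refine (connected_iff_exists_forall_reachable _).2 ⟨0, fun u => ?_⟩
  rcases h u with h | ⟨v, h, h'⟩ | ⟨v, w, h, h', h''⟩
  · exact h.reachable
  · exact h.reachable.trans h'.reachable
  · exact (h.reachable.trans h'.reachable).trans h''.reachable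

theorem three_le_card_of_block (T : Finset (Fin 8)) (hdom : ∀ v, v ≠ 0 → v ≠ 7 → v ∉ T →
    ∃ u ∈ T, block.Adj u v) (hind : ∀ u ∈ T, ∀ v ∈ T, ¬ block.Adj u v) : 3 ≤ T.card := by
  revert T
  decide +kernel

section blockChain

variable {α : Type*} (σ : Equiv.Perm α)

/-- The embedding of a copy of `block` in a chain. -/
def blockHom (i : α) : block →g blockChain σ where
  toFun u := (u, i)
  map_rel' h := Or.inl ⟨rfl, h⟩

theorem card_neighborSet_blockChain (x : Fin 8 × α) :
    Nat.card ((blockChain σ).neighborSet x) = 3 := by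
  obtain ⟨u, i⟩ := x
  let N : Finset (Fin 8) := {v | block.Adj u v ∨ (u = 7 ∧ v = 0) ∨ (u = 0 ∧ v = 7)}
  let f : Fin 8 → Fin 8 × α := fun v =>
    (v, if u = 7 ∧ v = 0 then σ i else if u = 0 ∧ v = 7 then σ.symm i else i)
  have hf : Function.Injective f := fun v w h => congrArg Prod.fst h
  have hN : N.card = 3 := by
    clear hf f
    revert u
    decide
  have hb : ∀ u v, block.Adj u v → ¬ (u = 7 ∧ v = 0) ∧ ¬ (u = 0 ∧ v = 7) := by decide
  have : (blockChain σ).neighborSet (u, i) = f '' N := by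
    ext ⟨v, j⟩
    simp only [mem_neighborSet, blockChain, Set.mem_image, Finset.mem_coe, f, N, Finset.mem_filter,
      Finset.mem_univ, true_and, Prod.mk.injEq]
    constructor
    · rintro (⟨rfl, h⟩ | ⟨rfl, rfl, rfl⟩ | ⟨rfl, rfl, rfl⟩)
      · exact ⟨v, Or.inl h, rfl, by rw [if_neg (hb u v h).1, if_neg (hb u v h).2]⟩
      · exact ⟨0, by simp⟩
      · exact ⟨7, by simp⟩
    · rintro ⟨_, h | ⟨rfl, rfl⟩ | ⟨rfl, rfl⟩, rfl, rfl⟩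
      · rw [if_neg (hb _ _ h).1, if_neg (hb _ _ h).2]
        exact Or.inl ⟨rfl, h⟩
      · simp
      · simp
  rw [this, Nat.card_coe_set_eq, Set.ncard_image_of_injective _ hf, Set.ncard_coe_finset, hN]

theorem isIndepDomSet_blockChain :
    IsIndepDomSet (blockChain σ) ((({2, 3, 4} : Finset (Fin 8)) : Set (Fin 8)) ×ˢ Set.univ) := by
  have hdom : ∀ v ∉ ({2, 3, 4} : Finset (Fin 8)), ∃ u ∈ ({2, 3, 4} : Finset (Fin 8)),
    block.Adj u v := by decide
  have hind : ∀ u ∈ ({2, 3, 4} : Finset (Fin 8)), u ≠ 7 ∧ u ≠ 0 ∧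
    ∀ v ∈ ({2, 3, 4} : Finset (Fin 8)), ¬ block.Adj u v := by decide
  constructor
  · rintro ⟨v, i⟩ hv
    obtain ⟨u, hu, h⟩ := hdom v fun h => hv ⟨h, trivial⟩
    exact ⟨(u, i), ⟨hu, trivial⟩, Or.inl ⟨rfl, h⟩⟩
  · rintro ⟨u, i⟩ ⟨hu, -⟩ ⟨v, j⟩ ⟨hv, -⟩ (⟨-, h⟩ | ⟨h, -⟩ | ⟨h, -⟩)
    · exact (hind u hu).2.2 v hv h
    · exact (hind u hu).1 h
    · exact (hind u hu).2.1 h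

theorem three_mul_card_le_ncard [Fintype α] {S : Set (Fin 8 × α)}
    (hS : IsIndepDomSet (blockChain σ) S) : 3 * Fintype.card α ≤ S.ncard := by
  classical
  have hfib (i : α) : 3 ≤ (S.toFinset.filter fun x => x.2 = i).card := by
    have h3 : 3 ≤ (Finset.univ.filter fun u : Fin 8 => (u, i) ∈ S).card := by
      apply three_le_card_of_block
      · intro v h0 h7 hv
        obtain ⟨⟨u, j⟩, hu, ⟨rfl, h⟩ | ⟨-, h, -⟩ | ⟨-, h, -⟩⟩ := hS.1 (v, i) (by simpa using hv)
        · exact ⟨u, by simpa using hu, h⟩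
        · exact absurd h h0
        · exact absurd h h7
      · intro u hu v hv h
        exact hS.2 (u, i) (by simpa using hu) (v, i) (by simpa using hv) (Or.inl ⟨rfl, h⟩)
    refine h3.trans (Finset.card_le_card_of_injOn (fun u => (u, i)) ?_ ?_)
    · intro u hu
      simpa using hu
    · intro u _ v _ h
      exact congrArg Prod.fst h
  rw [Set.ncard_eq_toFinset_card', Finset.card_eq_sum_card_fiberwise (f := Prod.snd)
    (t := Finset.univ) fun _ _ => Finset.mem_coe.2 (Finset.mem_univ _), mul_comm]
  simpa using Finset.card_nsmul_le_sum Finset.univ _ 3 fun i _ => hfib i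

theorem indepDomNum_blockChain [Fintype α] :
    indepDomNum (blockChain σ) = 3 * Fintype.card α := by
  have hcard : ((({2, 3, 4} : Finset (Fin 8)) : Set (Fin 8)) ×ˢ (Set.univ : Set α)).ncard =
      3 * Fintype.card α := by
    rw [Set.ncard_prod, Set.ncard_coe_finset, Set.ncard_univ, Nat.card_eq_fintype_card]
    rfl
  rw [indepDomNum_eq (isIndepDomSet_blockChain σ), hcard]
  intro T hT
  rw [hcard]
  exact three_mul_card_le_ncard σ hT

end blockChain

theorem blockChain_finRotate_connected (n : ℕ) : (blockChain (finRotate (n + 1))).Connected := by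
  have hcopy (i : Fin (n + 1)) (u v : Fin 8) :
      (blockChain (finRotate (n + 1))).Reachable (u, i) (v, i) :=
    (block_connected.preconnected u v).map (blockHom _ i)
  refine (connected_iff_exists_forall_reachable _).2 ⟨(0, 0), ?_⟩
  rintro ⟨u, i, hi⟩
  refine Reachable.trans ?_ (hcopy _ 0 u)
  induction i with
  | zero => rfl
  | succ i ih =>
    refine ((ih (by omega)).trans (hcopy _ 0 7)).trans (Adj.reachable (Or.inr (Or.inl ?_)))
    exact ⟨rfl, rfl, (finRotate_of_lt (by omega)).symm⟩

/-- For every `k ≥ 1` there exists a connected cubic graph of order `8k` with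
independent domination number `3k`. -/
theorem stmt_15 (k : ℕ) (hk : 1 ≤ k) :
    ∃ G : SimpleGraph (Fin (8 * k)), G.Connected ∧
      (∀ v, Nat.card (G.neighborSet v) = 3) ∧
      indepDomNum G = 3 * k := by
  obtain ⟨n, rfl⟩ := Nat.exists_eq_add_of_le' hk
  let e := Iso.map finProdFinEquiv (blockChain (finRotate (n + 1)))
  refine ⟨_, e.connected_iff.1 (blockChain_finRotate_connected n), fun v => ?_, ?_⟩
  · rw [← e.apply_symm_apply v, ← Nat.card_congr (e.mapNeighborSet _)]
    exact card_neighborSet_blockChain _ _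
  · rw [← indepDomNum_congr e, indepDomNum_blockChain, Fintype.card_fin]
end
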